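/- For every convex body K ⊆ ℝ² of unit area, let S be a set of n points drawn uniformly and independently at random from K, and let N₂(n) be the number of 4-holes H in S such that the pair of points of H at the largest distance among all pairs of points of H forms an edge of the convex quadrilateral conv(H) (i.e., the two points are consecutive vertices of conv(H)). Then n^{-2} · E[N₂(n)] converges to 8 − 2π²/3 as n → ∞. -/

import Mathlib

open MeasureTheory Filter

noncomputable section

abbrev Euc (d : ℕ) : Type := EuclideanSpace ℝ (Fin d)

/-- A convex body: compact convex set with nonempty interior. -/
def IsConvexBody {d : ℕ} (K : Set (Euc d)) : Prop :=
  Convex ℝ K ∧ IsCompact K ∧ (interior K).Nonempty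

/-- A set of points is in convex position if no point lies in the convex
hull of the others. -/
def InConvexPosition {d : ℕ} (P : Set (Euc d)) : Prop :=
  ∀ p ∈ P, p ∉ convexHull ℝ (P \ {p})

/-- `H` is a `k`-hole in `S`. -/
def IsHole {d : ℕ} (k : ℕ) (S H : Finset (Euc d)) : Prop :=
  H ⊆ S ∧ H.card = k ∧ InConvexPosition (H : Set (Euc d)) ∧
    ∀ p ∈ S, p ∉ interior (convexHull ℝ (H : Set (Euc d)))

open Classical in
/-- The number of `k`-holes in the point set given by `x`. -/
noncomputable def holeCount (d k n : ℕ) (x : Fin n → Euc d) : ℕ :=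
  ((Finset.image x Finset.univ).powerset.filter
    (fun H => IsHole k (Finset.image x Finset.univ) H)).card

/-- The uniform probability distribution on `K`. -/
noncomputable def unif {d : ℕ} (K : Set (Euc d)) : Measure (Euc d) :=
  (volume K)⁻¹ • volume.restrict K

/-- The expected number of `k`-holes among `n` points drawn uniformly and
independently at random from `K`. -/
noncomputable def EH (d k : ℕ) (K : Set (Euc d)) (n : ℕ) : ℝ :=
  ∫ x : Fin n → Euc d, (holeCount d k n x : ℝ) ∂(Measure.pi fun _ : Fin n => unif K)

/-- The probability that, for `d+2` points chosen uniformly and independently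
at random from `K`, one of the points lies in the convex hull of the others. -/
noncomputable def pSimplex (d : ℕ) (K : Set (Euc d)) : ℝ :=
  ((Measure.pi fun _ : Fin (d + 2) => unif K)
    {x : Fin (d + 2) → Euc d | ∃ i, x i ∈ convexHull ℝ (x '' {j | j ≠ i})}).toReal

/-- The maximum of `pSimplex d K` over all convex bodies `K ⊆ ℝ^d`. -/
noncomputable def pMax (d : ℕ) : ℝ :=
  sSup {p : ℝ | ∃ K : Set (Euc d), IsConvexBody K ∧ p = pSimplex d K}

end

open Classical in
/-- `H` is a 4-point set whose maximum-distance pair `{a, b}` forms an edge of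
the convex quadrilateral `conv H`, i.e. `a` and `b` are consecutive vertices:
the open segment `ab` does not cross the open segment spanned by the other two
points. -/
def MaxPairIsEdge (H : Finset (Euc 2)) : Prop :=
  ∃ a b c d : Euc 2, H = {a, b, c, d} ∧ H.card = 4 ∧
    (∀ p ∈ H, ∀ q ∈ H, dist p q ≤ dist a b) ∧
    openSegment ℝ a b ∩ openSegment ℝ c d = ∅

open Classical in
/-- The number of 4-holes of the point set given by `x` whose maximum-distance
pair forms an edge of the hole. -/
noncomputable def holeCountEdge (n : ℕ) (x : Fin n → Euc 2) : ℕ :=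
  ((Finset.image x Finset.univ).powerset.filter
    (fun H => IsHole 4 (Finset.image x Finset.univ) H ∧ MaxPairIsEdge H)).card

/-- The expected number of 4-holes of the second (edge) type among `n` points
drawn uniformly and independently at random from `K`. -/
noncomputable def EHedge (K : Set (Euc 2)) (n : ℕ) : ℝ :=
  ∫ x : Fin n → Euc 2, (holeCountEdge n x : ℝ) ∂(Measure.pi fun _ : Fin n => unif K)

/-- Twice the signed area of the triangle `a b c`. -/
def orient (a b c : Euc 2) : ℝ :=
  (b 0 - a 0) * (c 1 - a 1) - (b 1 - a 1) * (c 0 - a 0)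

/-- `a b c d` is a counterclockwise strictly convex quadrilateral in which no two vertices are
further apart than `a` and `b`. -/
def IsLongBaseQuad (a b c d : Euc 2) : Prop :=
  (0 < orient a b c ∧ 0 < orient a b d ∧ 0 < orient a c d ∧ 0 < orient b c d) ∧
  (dist a c ≤ dist a b ∧ dist a d ≤ dist a b ∧ dist b c ≤ dist a b ∧ dist b d ≤ dist a b ∧
    dist c d ≤ dist a b)

/-- The open region to the left of the four directed sides of `a b c d`. -/
def quadInterior (a b c d : Euc 2) : Set (Euc 2) :=
  {p | 0 < orient a b p ∧ 0 < orient b c p ∧ 0 < orient c d p ∧ 0 < orient d a p}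

lemma mem_of_barycentric {s : Set (Euc 2)} (hs : Convex ℝ s) {a b c p : Euc 2} (ha : a ∈ s)
    (hb : b ∈ s) (hc : c ∈ s) {A B C : ℝ} (hA : 0 ≤ A) (hB : 0 ≤ B) (hC : 0 ≤ C)
    (hpos : 0 < A + B + C) (h : ∀ i, (A + B + C) * p i = A * a i + B * b i + C * c i) :
    p ∈ s := by
  have key : p = ∑ i : Fin 3, (![A, B, C] i / (A + B + C)) • (![a, b, c] i) := by
    ext i
    have := h i
    simp [Fin.sum_univ_three]
    field_simp
    linarith
  rw [key]
  refine hs.sum_mem ?_ ?_ ?_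
  · intro i _
    fin_cases i <;> simp <;> positivity
  · simp [Fin.sum_univ_three]
    field_simp
  · intro i _
    fin_cases i <;> simpa

lemma orient_lineMap_aux (a b p q : Euc 2) (r t : ℝ) (h : r + t = 1) :
    orient a b (r • p + t • q) = r * orient a b p + t * orient a b q := by
  have : t = 1 - r := by linarith
  subst this
  simp [orient]
  ring

lemma convex_orient_nonneg (a b : Euc 2) : Convex ℝ {p | 0 ≤ orient a b p} := by
  intro p hp q hq r t hr ht h
  simp only [Set.mem_ofPred_eq] at *
  rw [orient_lineMap_aux _ _ _ _ _ _ h]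
  positivity

lemma convex_orient_nonpos (a b : Euc 2) : Convex ℝ {p | orient a b p ≤ 0} := by
  intro p hp q hq r t hr ht h
  simp only [Set.mem_ofPred_eq] at *
  rw [orient_lineMap_aux _ _ _ _ _ _ h]
  nlinarith

lemma continuous_orient_right (a b : Euc 2) : Continuous (orient a b) := by
  unfold orient; fun_prop

lemma orient_rotate (a b c : Euc 2) : orient b c a = orient a b c := by
  simp only [orient]; ring

lemma orient_swap_left (a b c : Euc 2) : orient b a c = - orient a b c := by
  simp only [orient]; ring

lemma orient_swap_right (a b c : Euc 2) : orient a c b = - orient a b c := by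
  simp only [orient]; ring

lemma orient_self_left (a b : Euc 2) : orient a b a = 0 := by
  simp only [orient]; ring

lemma orient_self_right (a b : Euc 2) : orient a b b = 0 := by
  simp only [orient]; ring

lemma orient_self (a b : Euc 2) : orient a a b = 0 := by
  simp only [orient]; ring

lemma IsLongBaseQuad.ne {a b c d : Euc 2} (h : IsLongBaseQuad a b c d) :
    a ≠ b ∧ a ≠ c ∧ a ≠ d ∧ b ≠ c ∧ b ≠ d ∧ c ≠ d := by
  obtain ⟨⟨h1, h2, h3, h4⟩, -⟩ := h
  refine ⟨?_, ?_, ?_, ?_, ?_, ?_⟩ <;> rintro rfl <;>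
    simp_all [orient_self, orient_self_left, orient_self_right]

lemma interior_convexHull_quad {a b c d : Euc 2} (h : IsLongBaseQuad a b c d) :
    interior (convexHull ℝ {a, b, c, d}) = quadInterior a b c d := by
  obtain ⟨⟨h1, h2, h3, h4⟩, -⟩ := h
  apply Set.Subset.antisymm
  · have key : ∀ u w v : Euc 2, 0 < orient u w v → v ∈ ({a, b, c, d} : Set (Euc 2)) →
        (∀ q ∈ ({a, b, c, d} : Set (Euc 2)), 0 ≤ orient u w q) →
        ∀ p ∈ interior (convexHull ℝ {a, b, c, d}), 0 < orient u w p := by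
      intro u w v huv hv hq p hp
      have hsub : convexHull ℝ {a, b, c, d} ⊆ {p | 0 ≤ orient u w p} :=
        convexHull_min (fun q hq' => hq q hq') (convex_orient_nonneg u w)
      have hcont : Tendsto (fun r : ℝ => p + r • (p - v)) (nhdsWithin 0 (Set.Ioi 0)) (nhds p) := by
        have : Continuous (fun r : ℝ => p + r • (p - v)) := by fun_prop
        have := this.tendsto 0
        simp only [zero_smul, add_zero] at this
        exact this.mono_left nhdsWithin_le_nhds
      have hev := hcont.eventually (mem_interior_iff_mem_nhds.mp hp)
      obtain ⟨r, hr, hr0⟩ := (hev.and self_mem_nhdsWithin).exists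
      have h0 := hsub hr
      have e : orient u w (p + r • (p - v)) = (1 + r) * orient u w p - r * orient u w v := by
        simp [orient]; ring
      simp only [Set.mem_ofPred_eq, e] at h0
      have hr0' : 0 < r := hr0
      nlinarith [mul_pos hr0' huv]
    intro p hp
    have a1 := orient_rotate b c a
    have a2 := orient_rotate c d a
    have a3 := orient_rotate c d b
    have a4 := orient_rotate d a b
    have a5 := orient_rotate d a c
    have b1 := orient_rotate a b c
    have b2 := orient_rotate a b d
    have b3 := orient_rotate a c d
    have b4 := orient_rotate b c d
    refine ⟨key a b c ?_ ?_ ?_ p hp, key b c d ?_ ?_ ?_ p hp, key c d a ?_ ?_ ?_ p hp,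
      key d a b ?_ ?_ ?_ p hp⟩
    all_goals first
      | (simp; done)
      | linarith
      | (rintro q (rfl | rfl | rfl | rfl) <;>
          (try simp only [orient_self_left, orient_self_right]) <;> linarith)
  · apply interior_maximal
    · rintro p ⟨p1, p2, p3, p4⟩
      have hc := convex_convexHull ℝ ({a, b, c, d} : Set (Euc 2))
      have ha : a ∈ convexHull ℝ {a, b, c, d} := subset_convexHull ℝ _ (by simp)
      have hb : b ∈ convexHull ℝ {a, b, c, d} := subset_convexHull ℝ _ (by simp)
      have hc' : c ∈ convexHull ℝ {a, b, c, d} := subset_convexHull ℝ _ (by simp)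
      have hd : d ∈ convexHull ℝ {a, b, c, d} := subset_convexHull ℝ _ (by simp)
      rcases le_total (orient a c p) 0 with hs | hs
      · refine mem_of_barycentric hc ha hb hc' p2.le (neg_nonneg.2 hs) p1.le ?_ ?_
        · linarith
        · intro i; fin_cases i <;> simp [orient] <;> ring
      · refine mem_of_barycentric hc ha hc' hd p3.le p4.le hs ?_ ?_
        · linarith
        · intro i; fin_cases i <;> simp [orient] <;> ring
    · have : quadInterior a b c d = (orient a b ⁻¹' Set.Ioi 0) ∩ ((orient b c ⁻¹' Set.Ioi 0) ∩
        ((orient c d ⁻¹' Set.Ioi 0) ∩ (orient d a ⁻¹' Set.Ioi 0))) := rfl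
      rw [this]
      have ho : ∀ u w, IsOpen (orient u w ⁻¹' Set.Ioi 0) :=
        fun u w => isOpen_Ioi.preimage (continuous_orient_right u w)
      exact (ho _ _).inter ((ho _ _).inter ((ho _ _).inter (ho _ _)))

lemma IsLongBaseQuad.inConvexPosition {a b c d : Euc 2} (h : IsLongBaseQuad a b c d) :
    InConvexPosition ({a, b, c, d} : Set (Euc 2)) := by
  have hne := h.ne
  obtain ⟨⟨h1, h2, h3, h4⟩, -⟩ := h
  have a1 := orient_swap_right a b c
  have a2 := orient_swap_right b c d
  have a3 := orient_rotate d a b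
  have a4 := orient_rotate a b d
  have e1 : ∀ p, p ∈ ({a, b, c, d} : Set (Euc 2)) → ∀ u w, 0 < orient u w p →
      (∀ q ∈ ({a, b, c, d} : Set (Euc 2)), q ≠ p → orient u w q ≤ 0) →
      p ∉ convexHull ℝ (({a, b, c, d} : Set (Euc 2)) \ {p}) := by
    intro p _ u w hp hq hmem
    have := convexHull_min (t := {q | orient u w q ≤ 0})
      (fun q hq' => hq q hq'.1 hq'.2) (convex_orient_nonpos u w) hmem
    simp only [Set.mem_ofPred_eq] at this
    linarith
  have s1 := orient_swap_left a c b
  have s2 := orient_swap_left a c d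
  have s3 := orient_swap_left b d a
  have s4 := orient_swap_left b d c
  rintro p (rfl | rfl | rfl | rfl)
  · refine e1 _ (by simp) b d (by linarith) ?_
    rintro q (rfl | rfl | rfl | rfl) hqp <;>
      simp_all only [orient_self_left, orient_self_right, le_refl, ne_eq,
        not_true_eq_false]
    linarith
  · refine e1 _ (by simp) c a (by linarith) ?_
    rintro q (rfl | rfl | rfl | rfl) hqp <;>
      simp_all only [orient_self_left, orient_self_right, le_refl, ne_eq,
        not_true_eq_false]
    linarith
  · refine e1 _ (by simp) d b (by linarith) ?_
    rintro q (rfl | rfl | rfl | rfl) hqp <;>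
      simp_all only [orient_self_left, orient_self_right, le_refl, ne_eq,
        not_true_eq_false]
    linarith
  · refine e1 _ (by simp) a c (by linarith) ?_
    rintro q (rfl | rfl | rfl | rfl) hqp <;>
      simp_all only [orient_self_left, orient_self_right, le_refl, ne_eq,
        not_true_eq_false]
    linarith

lemma IsLongBaseQuad.openSegment_inter {a b c d : Euc 2} (h : IsLongBaseQuad a b c d) :
    openSegment ℝ a b ∩ openSegment ℝ c d = ∅ := by
  obtain ⟨⟨h1, h2, h3, h4⟩, -⟩ := h
  ext p
  simp only [Set.mem_inter_iff, Set.mem_empty_iff_false, iff_false, not_and]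
  rintro ⟨r, t, hr, ht, hrt, rfl⟩ ⟨r', t', hr', ht', hrt', e⟩
  have e1 := orient_lineMap_aux a b a b r t hrt
  have e2 := orient_lineMap_aux a b c d r' t' hrt'
  rw [e, e1, orient_self_left, orient_self_right] at e2
  have := mul_pos hr' h1
  have := mul_pos ht' h2
  linarith

/-- The converse: a four-point set in convex position with a longest pair `a, b` forming an edge
can be labelled counterclockwise starting from that edge. -/
lemma exists_isLongBaseQuad_of_edge {a b c d : Euc 2}
    (hconv : InConvexPosition ({a, b, c, d} : Set (Euc 2)))
    (hab : a ≠ b) (hac : a ≠ c) (had : a ≠ d) (hbc : b ≠ c) (hbd : b ≠ d) (hcd : c ≠ d)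
    (g1 : orient a b c ≠ 0) (g2 : orient a b d ≠ 0) (g3 : orient a c d ≠ 0)
    (g4 : orient b c d ≠ 0)
    (hmax : dist a c ≤ dist a b ∧ dist a d ≤ dist a b ∧ dist b c ≤ dist a b ∧
      dist b d ≤ dist a b ∧ dist c d ≤ dist a b)
    (hdisj : openSegment ℝ a b ∩ openSegment ℝ c d = ∅) :
    IsLongBaseQuad a b c d ∨ IsLongBaseQuad a b d c ∨ IsLongBaseQuad b a c d ∨
      IsLongBaseQuad b a d c := by
  have hsum : orient a b c - orient a b d + orient a c d - orient b c d = 0 := by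
    simp only [orient]; ring
  have hbary : ∀ i, orient a b c * d i - orient a b d * c i + orient a c d * b i
      - orient b c d * a i = 0 := by
    intro i; fin_cases i <;> simp [orient] <;> ring
  have cv : ∀ P : Set (Euc 2), Convex ℝ (convexHull ℝ P) := fun P => convex_convexHull ℝ P
  have na : ∀ A B C : ℝ, 0 ≤ A → 0 ≤ B → 0 ≤ C → 0 < A + B + C →
      (∀ i, (A + B + C) * a i = A * b i + B * c i + C * d i) → False := by
    intro A B C hA hB hC hp he
    exact hconv a (by simp) (mem_of_barycentric (cv _)
      (subset_convexHull ℝ _ ⟨by simp, hab.symm⟩) (subset_convexHull ℝ _ ⟨by simp, hac.symm⟩)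
      (subset_convexHull ℝ _ ⟨by simp, had.symm⟩) hA hB hC hp he)
  have nb : ∀ A B C : ℝ, 0 ≤ A → 0 ≤ B → 0 ≤ C → 0 < A + B + C →
      (∀ i, (A + B + C) * b i = A * a i + B * c i + C * d i) → False := by
    intro A B C hA hB hC hp he
    exact hconv b (by simp) (mem_of_barycentric (cv _)
      (subset_convexHull ℝ _ ⟨by simp, hab⟩) (subset_convexHull ℝ _ ⟨by simp, hbc.symm⟩)
      (subset_convexHull ℝ _ ⟨by simp, hbd.symm⟩) hA hB hC hp he)
  have nc : ∀ A B C : ℝ, 0 ≤ A → 0 ≤ B → 0 ≤ C → 0 < A + B + C →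
      (∀ i, (A + B + C) * c i = A * a i + B * b i + C * d i) → False := by
    intro A B C hA hB hC hp he
    exact hconv c (by simp) (mem_of_barycentric (cv _)
      (subset_convexHull ℝ _ ⟨by simp, hac⟩) (subset_convexHull ℝ _ ⟨by simp, hbc⟩)
      (subset_convexHull ℝ _ ⟨by simp, hcd.symm⟩) hA hB hC hp he)
  have nd : ∀ A B C : ℝ, 0 ≤ A → 0 ≤ B → 0 ≤ C → 0 < A + B + C →
      (∀ i, (A + B + C) * d i = A * a i + B * b i + C * c i) → False := by
    intro A B C hA hB hC hp he
    exact hconv d (by simp) (mem_of_barycentric (cv _)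
      (subset_convexHull ℝ _ ⟨by simp, had⟩) (subset_convexHull ℝ _ ⟨by simp, hbd⟩)
      (subset_convexHull ℝ _ ⟨by simp, hcd⟩) hA hB hC hp he)
  have ncross : ∀ A B C D : ℝ, 0 < A → 0 < B → 0 < C → 0 < D → A + B = C + D →
      (∀ i, A * a i + B * b i = C * c i + D * d i) → False := by
    intro A B C D hA hB hC hD hs he
    have hmem : (A / (A + B)) • a + (B / (A + B)) • b ∈
        openSegment ℝ a b ∩ openSegment ℝ c d := by
      refine ⟨⟨A / (A + B), B / (A + B), by positivity, by positivity, by field_simp, rfl⟩,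
        ⟨C / (A + B), D / (A + B), by positivity, by positivity, by rw [← add_div, ← hs]; field_simp, ?_⟩⟩
      ext i
      have := he i
      simp
      field_simp
      linarith
    rw [hdisj] at hmem
    exact hmem
  have hdab : dist b a = dist a b := dist_comm b a
  have hdcd : dist d c = dist c d := dist_comm d c
  have s1 := orient_swap_left a b c
  have s2 := orient_swap_left a b d
  have s3 := orient_swap_right a c d
  have s4 := orient_swap_right b c d
  simp only [IsLongBaseQuad, hdab, hdcd, s1, s2, s3, s4]
  obtain ⟨m1, m2, m3, m4, m5⟩ := hmax
  simp only [m1, m2, m3, m4, m5, and_true]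
  rcases lt_or_gt_of_ne g1 with k1 | k1 <;> rcases lt_or_gt_of_ne g2 with k2 | k2 <;>
    rcases lt_or_gt_of_ne g3 with k3 | k3 <;> rcases lt_or_gt_of_ne g4 with k4 | k4
  all_goals first
    | (left; refine ⟨?_, ?_, ?_, ?_⟩ <;> linarith)
    | (right; left; refine ⟨?_, ?_, ?_, ?_⟩ <;> linarith)
    | (right; right; left; refine ⟨?_, ?_, ?_, ?_⟩ <;> linarith)
    | (right; right; right; refine ⟨?_, ?_, ?_, ?_⟩ <;> linarith)
    | exfalso
  all_goals first
    | exact na (orient a c d) (-orient a b d) (orient a b c) (by linarith) (by linarith)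
        (by linarith) (by linarith) (fun i => by linear_combination (a i) * hsum - hbary i)
    | exact na (-orient a c d) (orient a b d) (-orient a b c) (by linarith) (by linarith)
        (by linarith) (by linarith) (fun i => by linear_combination -(a i) * hsum + hbary i)
    | exact nb (orient b c d) (orient a b d) (-orient a b c) (by linarith) (by linarith)
        (by linarith) (by linarith) (fun i => by linear_combination -(b i) * hsum + hbary i)
    | exact nb (-orient b c d) (-orient a b d) (orient a b c) (by linarith) (by linarith)
        (by linarith) (by linarith) (fun i => by linear_combination (b i) * hsum - hbary i)
    | exact nc (-orient b c d) (orient a c d) (orient a b c) (by linarith) (by linarith)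
        (by linarith) (by linarith) (fun i => by linear_combination (c i) * hsum - hbary i)
    | exact nc (orient b c d) (-orient a c d) (-orient a b c) (by linarith) (by linarith)
        (by linarith) (by linarith) (fun i => by linear_combination -(c i) * hsum + hbary i)
    | exact nd (orient b c d) (-orient a c d) (orient a b d) (by linarith) (by linarith)
        (by linarith) (by linarith) (fun i => by linear_combination -(d i) * hsum + hbary i)
    | exact nd (-orient b c d) (orient a c d) (-orient a b d) (by linarith) (by linarith)
        (by linarith) (by linarith) (fun i => by linear_combination (d i) * hsum - hbary i)
    | exact ncross (orient b c d) (-orient a c d) (-orient a b d) (orient a b c) (by linarith)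
        (by linarith) (by linarith) (by linarith) (by linarith)
        (fun i => by linear_combination - hbary i)
    | exact ncross (-orient b c d) (orient a c d) (orient a b d) (-orient a b c) (by linarith)
        (by linarith) (by linarith) (by linarith) (by linarith)
        (fun i => by linear_combination hbary i)

/-- No two pairs of distinct sample points span the same distance, no three are collinear and no
two coincide. -/
structure IsGenericSample {n : ℕ} (x : Fin n → Euc 2) : Prop where
  injective : Function.Injective x
  generic : ∀ i j k l : Fin n, i ≠ j → i ≠ k → i ≠ l → j ≠ k → j ≠ l → k ≠ l →
    orient (x i) (x j) (x l) ≠ 0 ∧ dist (x l) (x i) ≠ dist (x i) (x j) ∧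
      dist (x l) (x i) ≠ dist (x j) (x k)

/-- The event that the points indexed by `e` form a counterclockwise quadrilateral whose first edge
is longest and which contains no other sample point in its interior. -/
def holeEvent {n : ℕ} (e : Fin 4 ↪ Fin n) : Set (Fin n → Euc 2) :=
  {x | IsLongBaseQuad (x (e 0)) (x (e 1)) (x (e 2)) (x (e 3)) ∧
    ∀ m, m ∉ Set.range e → x m ∉ quadInterior (x (e 0)) (x (e 1)) (x (e 2)) (x (e 3))}

lemma IsLongBaseQuad.eq_of_same_vertices {a b c d a' b' c' d' : Euc 2}
    (h : IsLongBaseQuad a b c d) (h' : IsLongBaseQuad a' b' c' d')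
    (hset : ({a', b', c', d'} : Set (Euc 2)) = {a, b, c, d})
    (hac : dist a c ≠ dist a b) (had : dist a d ≠ dist a b) (hbc : dist b c ≠ dist a b)
    (hbd : dist b d ≠ dist a b) (hcd : dist c d ≠ dist a b) :
    a' = a ∧ b' = b ∧ c' = c ∧ d' = d := by
  have hne := h.ne
  have hne' := h'.ne
  obtain ⟨⟨o1, o2, o3, o4⟩, m1, m2, m3, m4, m5⟩ := h
  obtain ⟨⟨o1', o2', o3', o4'⟩, m'⟩ := h'
  have ma' : a' ∈ ({a, b, c, d} : Set (Euc 2)) := by rw [← hset]; simp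
  have mb' : b' ∈ ({a, b, c, d} : Set (Euc 2)) := by rw [← hset]; simp
  have mc' : c' ∈ ({a, b, c, d} : Set (Euc 2)) := by rw [← hset]; simp
  have md' : d' ∈ ({a, b, c, d} : Set (Euc 2)) := by rw [← hset]; simp
  have ma : a ∈ ({a', b', c', d'} : Set (Euc 2)) := by rw [hset]; simp
  have mb : b ∈ ({a', b', c', d'} : Set (Euc 2)) := by rw [hset]; simp
  have hle : dist a b ≤ dist a' b' := by
    obtain ⟨m1', m2', m3', m4', m5'⟩ := m'
    rcases ma with rfl | rfl | rfl | rfl <;> rcases mb with rfl | rfl | rfl | rfl <;>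
      simp_all [dist_comm]
  replace hac := lt_of_le_of_ne m1 hac
  replace had := lt_of_le_of_ne m2 had
  replace hbc := lt_of_le_of_ne m3 hbc
  replace hbd := lt_of_le_of_ne m4 hbd
  replace hcd := lt_of_le_of_ne m5 hcd
  have c1 := dist_comm a c
  have c2 := dist_comm a d
  have c3 := dist_comm b c
  have c4 := dist_comm b d
  have c5 := dist_comm c d
  have hab : (a' = a ∧ b' = b) ∨ (a' = b ∧ b' = a) := by
    rcases ma' with rfl | rfl | rfl | rfl <;> rcases mb' with rfl | rfl | rfl | rfl <;>
      first
      | exact absurd rfl hne'.1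
      | exact Or.inl ⟨rfl, rfl⟩
      | exact Or.inr ⟨rfl, rfl⟩
      | (exfalso; linarith)
  rcases hab with ⟨rfl, rfl⟩ | ⟨rfl, rfl⟩
  · rcases mc' with rfl | rfl | rfl | rfl <;> rcases md' with rfl | rfl | rfl | rfl <;>
      first
      | exact ⟨rfl, rfl, rfl, rfl⟩
      | (exfalso; simp_all; done)
      | (exfalso; have := orient_swap_right a' c' d'; linarith)
  · have s1 := orient_swap_left a' b' c
    have s2 := orient_swap_left a' b' d
    rcases mc' with rfl | rfl | rfl | rfl
    · exact absurd rfl hne'.2.2.2.1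
    · exact absurd rfl hne'.2.1
    · exfalso; linarith
    · exfalso; linarith

lemma IsLongBaseQuad.dist_le {a b c d p q : Euc 2} (h : IsLongBaseQuad a b c d)
    (hp : p = a ∨ p = b ∨ p = c ∨ p = d) (hq : q = a ∨ q = b ∨ q = c ∨ q = d) :
    dist p q ≤ dist a b := by
  obtain ⟨-, m1, m2, m3, m4, m5⟩ := h
  have h0 : 0 ≤ dist a b := dist_nonneg
  have c0 := dist_comm a b
  have c1 := dist_comm a c
  have c2 := dist_comm a d
  have c3 := dist_comm b c
  have c4 := dist_comm b d
  have c5 := dist_comm c d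
  rcases hp with rfl | rfl | rfl | rfl <;> rcases hq with rfl | rfl | rfl | rfl <;>
    first | linarith | (rw [dist_self]; linarith)

lemma injective_vec_four {α : Type*} {p q r s : α} (hpq : p ≠ q) (hpr : p ≠ r) (hps : p ≠ s)
    (hqr : q ≠ r) (hqs : q ≠ s) (hrs : r ≠ s) : Function.Injective ![p, q, r, s] := by
  intro u v huv
  fin_cases u <;> fin_cases v <;> first | rfl | (exfalso; simp at huv; grind)

lemma ne_of_card_eq_four {α : Type*} [DecidableEq α] {a b c d : α}
    (h : ({a, b, c, d} : Finset α).card = 4) :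
    a ≠ b ∧ a ≠ c ∧ a ≠ d ∧ b ≠ c ∧ b ≠ d ∧ c ≠ d := by
  have h3 : ∀ p q r : α, ({a, b, c, d} : Finset α) ≠ {p, q, r} := by
    intro p q r hp
    have := Finset.card_le_three (a := p) (b := q) (c := r)
    rw [← hp, h] at this
    omega
  refine ⟨?_, ?_, ?_, ?_, ?_, ?_⟩ <;> rintro rfl
  exacts [h3 a c d (by simp), h3 a b d (by grind), h3 a b c (by grind), h3 a b d (by simp),
    h3 a b c (by grind), h3 a b c (by simp)]

open Classical in
lemma holeCountEdge_eq_card {n : ℕ} {x : Fin n → Euc 2} (hx : IsGenericSample x) :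
    holeCountEdge n x = (Finset.univ.filter (fun e : Fin 4 ↪ Fin n => x ∈ holeEvent e)).card := by
  symm
  unfold holeCountEdge
  have himg : ∀ e : Fin 4 ↪ Fin n, Finset.image (fun i => x (e i)) Finset.univ
      = {x (e 0), x (e 1), x (e 2), x (e 3)} := by
    intro e; ext p; simp [Fin.exists_fin_succ, eq_comm]
  have hcoe : ∀ e : Fin 4 ↪ Fin n,
      ((Finset.image (fun i => x (e i)) Finset.univ : Finset (Euc 2)) : Set (Euc 2))
      = {x (e 0), x (e 1), x (e 2), x (e 3)} := by
    intro e; rw [himg]; simp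
  refine Finset.card_bij (fun e _ => Finset.image (fun i => x (e i)) Finset.univ) ?_ ?_ ?_
  · intro e he
    obtain ⟨hq, hempty⟩ := (Finset.mem_filter.1 he).2
    have hne := hq.ne
    have hcard : (Finset.image (fun i => x (e i)) Finset.univ).card = 4 := by
      rw [Finset.card_image_of_injective (f := fun i => x (e i)) _
        (hx.injective.comp e.injective)]
      simp
    have hsub : Finset.image (fun i => x (e i)) Finset.univ ⊆ Finset.image x Finset.univ := by
      intro p hp
      obtain ⟨i, -, rfl⟩ := Finset.mem_image.1 hp
      exact Finset.mem_image_of_mem x (Finset.mem_univ _)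
    refine Finset.mem_filter.2 ⟨Finset.mem_powerset.2 hsub, ⟨hsub, hcard, ?_, ?_⟩, ?_⟩
    · rw [hcoe]; exact hq.inConvexPosition
    · intro p hp
      rw [hcoe, interior_convexHull_quad hq]
      obtain ⟨m, -, rfl⟩ := Finset.mem_image.1 hp
      by_cases hm : m ∈ Set.range e
      · obtain ⟨i, rfl⟩ := hm
        rintro ⟨h1, h2, h3, h4⟩
        fin_cases i <;> simp_all [orient_self_left, orient_self_right]
      · exact hempty m hm
    · refine ⟨x (e 0), x (e 1), x (e 2), x (e 3), himg e, hcard, ?_, hq.openSegment_inter⟩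
      rw [himg]
      exact fun p hp q hq' => hq.dist_le (by simpa using hp) (by simpa using hq')
  · intro e he e' he' heq
    have h1 := (Finset.mem_filter.1 he).2.1
    have h2 := (Finset.mem_filter.1 he').2.1
    have hset : ({x (e' 0), x (e' 1), x (e' 2), x (e' 3)} : Set (Euc 2))
        = {x (e 0), x (e 1), x (e 2), x (e 3)} := by
      have heq' : Finset.image (fun i => x (e i)) Finset.univ
          = Finset.image (fun i => x (e' i)) Finset.univ := heq
      rw [← hcoe e, ← hcoe e', heq']
    have hg := hx.generic
    have hi : ∀ i j : Fin 4, i ≠ j → e i ≠ e j := fun i j h => e.injective.ne h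
    have hac := (hg (e 0) (e 1) (e 3) (e 2) (hi _ _ (by decide)) (hi _ _ (by decide))
      (hi _ _ (by decide)) (hi _ _ (by decide)) (hi _ _ (by decide)) (hi _ _ (by decide))).2.1
    have had := (hg (e 0) (e 1) (e 2) (e 3) (hi _ _ (by decide)) (hi _ _ (by decide))
      (hi _ _ (by decide)) (hi _ _ (by decide)) (hi _ _ (by decide)) (hi _ _ (by decide))).2.1
    have hbc := (hg (e 1) (e 0) (e 3) (e 2) (hi _ _ (by decide)) (hi _ _ (by decide))
      (hi _ _ (by decide)) (hi _ _ (by decide)) (hi _ _ (by decide)) (hi _ _ (by decide))).2.1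
    have hbd := (hg (e 1) (e 0) (e 2) (e 3) (hi _ _ (by decide)) (hi _ _ (by decide))
      (hi _ _ (by decide)) (hi _ _ (by decide)) (hi _ _ (by decide)) (hi _ _ (by decide))).2.1
    have hcd := (hg (e 2) (e 0) (e 1) (e 3) (hi _ _ (by decide)) (hi _ _ (by decide))
      (hi _ _ (by decide)) (hi _ _ (by decide)) (hi _ _ (by decide)) (hi _ _ (by decide))).2.2
    rw [dist_comm] at hac had hbc hbd hcd
    rw [dist_comm (x (e 1)) (x (e 0))] at hbc hbd
    obtain ⟨r0, r1, r2, r3⟩ := h1.eq_of_same_vertices h2 hset hac had hbc hbd hcd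
    ext i : 1
    apply hx.injective
    fin_cases i
    exacts [r0.symm, r1.symm, r2.symm, r3.symm]
  · intro H hH
    obtain ⟨hsub, ⟨-, hcard, hconv, hempty⟩, a, b, c, d, rfl, -, hmax, hdisj⟩ :=
      Finset.mem_filter.1 hH
    rw [Finset.mem_powerset] at hsub
    obtain ⟨hab, hac, had, hbc, hbd, hcd⟩ := ne_of_card_eq_four hcard
    obtain ⟨i, -, rfl⟩ := Finset.mem_image.1 (hsub (by simp : a ∈ _))
    obtain ⟨j, -, rfl⟩ := Finset.mem_image.1 (hsub (by simp : b ∈ _))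
    obtain ⟨k, -, rfl⟩ := Finset.mem_image.1 (hsub (by simp : c ∈ _))
    obtain ⟨l, -, rfl⟩ := Finset.mem_image.1 (hsub (by simp : d ∈ _))
    have hij := ne_of_apply_ne x hab
    have hik := ne_of_apply_ne x hac
    have hil := ne_of_apply_ne x had
    have hjk := ne_of_apply_ne x hbc
    have hjl := ne_of_apply_ne x hbd
    have hkl := ne_of_apply_ne x hcd
    have hg := hx.generic
    have hcases := exists_isLongBaseQuad_of_edge (by simpa using hconv) hab hac had hbc hbd hcd
      (hg i j l k hij hil hik hjl hjk hkl.symm).1 (hg i j k l hij hik hil hjk hjl hkl).1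
      (hg i k j l hik hij hil hjk.symm hkl hjl).1 (hg j k i l hjk hij.symm hjl hik.symm hkl hil).1
      ⟨hmax _ (by simp) _ (by simp), hmax _ (by simp) _ (by simp), hmax _ (by simp) _ (by simp),
        hmax _ (by simp) _ (by simp), hmax _ (by simp) _ (by simp)⟩ hdisj
    have build : ∀ p q r s : Fin n, p ≠ q → p ≠ r → p ≠ s → q ≠ r → q ≠ s → r ≠ s →
        IsLongBaseQuad (x p) (x q) (x r) (x s) →
        ({x p, x q, x r, x s} : Finset (Euc 2)) = {x i, x j, x k, x l} →
        ∃ e, ∃ _ : e ∈ Finset.univ.filter (fun e : Fin 4 ↪ Fin n => x ∈ holeEvent e),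
          Finset.image (fun i => x (e i)) Finset.univ = {x i, x j, x k, x l} := by
      intro p q r s hpq hpr hps hqr hqs hrs hquad hseteq
      let e : Fin 4 ↪ Fin n := ⟨![p, q, r, s], injective_vec_four hpq hpr hps hqr hqs hrs⟩
      refine ⟨e, Finset.mem_filter.2 ⟨Finset.mem_univ _, hquad, ?_⟩, ?_⟩
      · intro m _
        have := hempty (x m) (Finset.mem_image_of_mem x (Finset.mem_univ _))
        rw [← hseteq] at this
        have hc : ((({x p, x q, x r, x s} : Finset (Euc 2)) : Set (Euc 2)))
          = {x p, x q, x r, x s} := by simp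
        rw [hc, interior_convexHull_quad hquad] at this
        exact this
      · rw [himg, ← hseteq]; rfl
    rcases hcases with h | h | h | h
    · exact build i j k l hij hik hil hjk hjl hkl h rfl
    · exact build i j l k hij hil hik hjl hjk hkl.symm h (by grind)
    · exact build j i k l hij.symm hjk hjl hik hil hkl h (by grind)
    · exact build j i l k hij.symm hjl hjk hil hik hkl.symm h (by grind)

section Marginals

variable {E : Type*} [MeasurableSpace E] (μ : Measure E) [IsProbabilityMeasure μ]

/-- Splitting an i.i.d. sample into the points indexed by an embedding and the other points. -/
lemma measurePreserving_split {k n : ℕ} (e : Fin k ↪ Fin n) :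
    MeasurePreserving
      (fun x : Fin n → E => ((fun i => x (e i)), fun m : {m // m ∉ Set.range e} => x m))
      (Measure.pi fun _ => μ) ((Measure.pi fun _ => μ).prod (Measure.pi fun _ => μ)) := by
  classical
  let σ : Fin k ⊕ {m // m ∉ Set.range e} ≃ Fin n :=
    (Equiv.sumCongr (Equiv.ofInjective e e.injective) (Equiv.refl _)).trans
      (Equiv.sumCompl (fun m => m ∈ Set.range e))
  have h1 := (measurePreserving_piCongrLeft (fun _ : Fin n => μ) σ).symm
  have h2 := measurePreserving_sumPiEquivProdPi
    (fun _ : Fin k ⊕ {m // m ∉ Set.range e} => μ)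
  exact h2.comp h1

lemma measurePreserving_comp_embedding {k n : ℕ} (e : Fin k ↪ Fin n) :
    MeasurePreserving (fun x : Fin n → E => fun i => x (e i))
      (Measure.pi fun _ => μ) (Measure.pi fun _ => μ) :=
  measurePreserving_fst.comp (measurePreserving_split μ e)

lemma lintegral_pi_succ {k : ℕ} {f : (Fin (k + 1) → E) → ENNReal} (hf : Measurable f) :
    ∫⁻ z, f z ∂(Measure.pi fun _ => μ)
      = ∫⁻ a, ∫⁻ z, f (Fin.cons a z) ∂(Measure.pi fun _ => μ) ∂μ := by
  have h := (measurePreserving_piFinSuccAbove (fun _ : Fin (k + 1) => μ) 0).symm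
  rw [← h.lintegral_comp hf, lintegral_prod]
  · simp [MeasurableEquiv.piFinSuccAbove, Fin.insertNthEquiv]
  · exact (hf.comp (MeasurableEquiv.measurable _)).aemeasurable

lemma lintegral_pi_four {f : (Fin 4 → E) → ENNReal} (hf : Measurable f) :
    ∫⁻ z, f z ∂(Measure.pi fun _ => μ)
      = ∫⁻ a, ∫⁻ b, ∫⁻ c, ∫⁻ d, f ![a, b, c, d] ∂μ ∂μ ∂μ ∂μ := by
  have hc : ∀ (k : ℕ) (a : E), Measurable (fun z : Fin k → E =>
      (Fin.cons a z : Fin (k + 1) → E)) := by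
    intro k a
    refine measurable_pi_lambda _ fun i => ?_
    refine Fin.cases ?_ (fun j => ?_) i
    · simp
    · simpa using measurable_pi_apply j
  rw [lintegral_pi_succ μ hf]
  congr with a
  have h1 := hf.comp (hc 3 a)
  refine (lintegral_pi_succ μ h1).trans ?_
  congr with b
  have h2 := h1.comp (hc 2 b)
  refine (lintegral_pi_succ μ h2).trans ?_
  congr with c
  have h3 := h2.comp (hc 1 c)
  refine (lintegral_pi_succ μ h3).trans ?_
  congr with d
  simp [lintegral_unique]
  congr 1

end Marginals

lemma volume_orient_eq_zero {a b : Euc 2} (hab : a ≠ b) :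
    volume {p : Euc 2 | orient a b p = 0} = 0 := by
  let s : AffineSubspace ℝ (Euc 2) :=
    { carrier := {p | orient a b p = 0}
      smul_vsub_vadd_mem' := by
        intro c p q r hp hq hr
        simp only [Set.mem_ofPred_eq, orient] at *
        simp
        linear_combination c * hp - c * hq + hr }
  have hs : s ≠ ⊤ := by
    intro h
    have hmem : a + !₂[-(b 1 - a 1), b 0 - a 0] ∈ s := by rw [h]; trivial
    have h0 : orient a b (a + !₂[-(b 1 - a 1), b 0 - a 0]) = 0 := hmem
    simp [orient] at h0
    apply hab
    have h1 : b 0 - a 0 = 0 := pow_eq_zero_iff two_ne_zero |>.1 <| by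
      nlinarith [sq_nonneg (b 0 - a 0), sq_nonneg (b 1 - a 1)]
    have h2 : b 1 - a 1 = 0 := pow_eq_zero_iff two_ne_zero |>.1 <| by
      nlinarith [sq_nonneg (b 0 - a 0), sq_nonneg (b 1 - a 1)]
    ext i
    fin_cases i
    · simp; linarith
    · simp; linarith
  exact Measure.addHaar_affineSubspace volume s hs

section Measurability

variable {α : Type*} [MeasurableSpace α] {f g h k p : α → Euc 2}

lemma Measurable.orient (hf : Measurable f) (hg : Measurable g) (hh : Measurable h) :
    Measurable fun x => _root_.orient (f x) (g x) (h x) := by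
  have hc : ∀ {u : α → Euc 2} (i : Fin 2), Measurable u → Measurable fun x => u x i := by
    intro u i hu
    have : Continuous fun v : Euc 2 => v i := by fun_prop
    exact this.measurable.comp hu
  unfold _root_.orient
  exact (((hc 0 hg).sub (hc 0 hf)).mul ((hc 1 hh).sub (hc 1 hf))).sub
    (((hc 1 hg).sub (hc 1 hf)).mul ((hc 0 hh).sub (hc 0 hf)))

lemma measurableSet_isLongBaseQuad (hf : Measurable f) (hg : Measurable g) (hh : Measurable h)
    (hk : Measurable k) : MeasurableSet {x | IsLongBaseQuad (f x) (g x) (h x) (k x)} := by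
  have ho : ∀ {u v w : α → Euc 2}, Measurable u → Measurable v → Measurable w →
      MeasurableSet {x | 0 < orient (u x) (v x) (w x)} :=
    fun hu hv hw => measurableSet_lt measurable_const (hu.orient hv hw)
  have hd : ∀ {u v : α → Euc 2}, Measurable u → Measurable v →
      MeasurableSet {x | dist (u x) (v x) ≤ dist (f x) (g x)} :=
    fun hu hv => measurableSet_le (hu.dist hv) (hf.dist hg)
  exact ((ho hf hg hh).inter ((ho hf hg hk).inter ((ho hf hh hk).inter (ho hg hh hk)))).inter
    ((hd hf hh).inter ((hd hf hk).inter ((hd hg hh).inter ((hd hg hk).inter (hd hh hk)))))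

lemma measurableSet_mem_quadInterior (hf : Measurable f) (hg : Measurable g) (hh : Measurable h)
    (hk : Measurable k) (hp : Measurable p) :
    MeasurableSet {x | p x ∈ quadInterior (f x) (g x) (h x) (k x)} := by
  have ho : ∀ {u v w : α → Euc 2}, Measurable u → Measurable v → Measurable w →
      MeasurableSet {x | 0 < orient (u x) (v x) (w x)} :=
    fun hu hv hw => measurableSet_lt measurable_const (hu.orient hv hw)
  exact (ho hf hg hp).inter ((ho hg hh hp).inter ((ho hh hk hp).inter (ho hk hf hp)))

end Measurability

lemma ae_generic_four {μ : Measure (Euc 2)} [IsProbabilityMeasure μ] (hμ : μ ≪ volume) :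
    ∀ᵐ z : Fin 4 → Euc 2 ∂(Measure.pi fun _ => μ), orient (z 0) (z 1) (z 3) ≠ 0 ∧
      dist (z 3) (z 0) ≠ dist (z 0) (z 1) ∧ dist (z 3) (z 0) ≠ dist (z 1) (z 2) := by
  have hm : ∀ i : Fin 4, Measurable fun z : Fin 4 → Euc 2 => z i := measurable_pi_apply
  have hbad : MeasurableSet {z : Fin 4 → Euc 2 | ¬ (orient (z 0) (z 1) (z 3) ≠ 0 ∧
      dist (z 3) (z 0) ≠ dist (z 0) (z 1) ∧ dist (z 3) (z 0) ≠ dist (z 1) (z 2))} := by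
    refine MeasurableSet.compl (MeasurableSet.inter ?_ (MeasurableSet.inter ?_ ?_)) <;>
      refine MeasurableSet.compl (measurableSet_eq_fun ?_ ?_)
    · exact (hm 0).orient (hm 1) (hm 3)
    · exact measurable_const
    · exact (hm 3).dist (hm 0)
    · exact (hm 0).dist (hm 1)
    · exact (hm 3).dist (hm 0)
    · exact (hm 1).dist (hm 2)
  rw [ae_iff, ← lintegral_indicator_one hbad,
    lintegral_pi_four μ (measurable_one.indicator hbad)]
  refine (lintegral_congr_ae (ae_of_all _ fun a => ?_)).trans lintegral_zero
  have hb : ∀ᵐ b ∂μ, b ≠ a := hμ.ae_le (compl_mem_ae_iff.2 (measure_singleton a))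
  refine (lintegral_congr_ae (hb.mono fun b hba => ?_)).trans lintegral_zero
  refine (lintegral_congr_ae (ae_of_all _ fun c => ?_)).trans lintegral_zero
  have h1 : ∀ᵐ d ∂μ, orient a b d ≠ 0 := 
    hμ.ae_le (compl_mem_ae_iff.2 (volume_orient_eq_zero hba.symm))
  have h2 : ∀ r : ℝ, ∀ᵐ d ∂μ, dist d a ≠ r := fun r => 
    hμ.ae_le (compl_mem_ae_iff.2 (Measure.addHaar_sphere volume a r))
  refine (lintegral_congr_ae ?_).trans lintegral_zero
  filter_upwards [h1, h2 (dist a b), h2 (dist b c)] with d e1 e2 e3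
  refine Set.indicator_of_notMem ?_ _
  simp [e1, e2, e3]

lemma ae_isGenericSample {n : ℕ} (hn : 4 ≤ n) {μ : Measure (Euc 2)} [IsProbabilityMeasure μ]
    (hμ : μ ≪ volume) : ∀ᵐ x : Fin n → Euc 2 ∂(Measure.pi fun _ => μ), IsGenericSample x := by
  have h : ∀ᵐ x : Fin n → Euc 2 ∂(Measure.pi fun _ => μ), ∀ e : Fin 4 ↪ Fin n,
      orient (x (e 0)) (x (e 1)) (x (e 3)) ≠ 0 ∧
      dist (x (e 3)) (x (e 0)) ≠ dist (x (e 0)) (x (e 1)) ∧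
      dist (x (e 3)) (x (e 0)) ≠ dist (x (e 1)) (x (e 2)) := by
    rw [ae_all_iff]
    exact fun e => (measurePreserving_comp_embedding μ e).quasiMeasurePreserving.ae
      (ae_generic_four hμ)
  filter_upwards [h] with x hx
  have hgen : ∀ i j k l : Fin n, i ≠ j → i ≠ k → i ≠ l → j ≠ k → j ≠ l → k ≠ l →
      orient (x i) (x j) (x l) ≠ 0 ∧ dist (x l) (x i) ≠ dist (x i) (x j) ∧
        dist (x l) (x i) ≠ dist (x j) (x k) :=
    fun i j k l h1 h2 h3 h4 h5 h6 => hx ⟨![i, j, k, l], injective_vec_four h1 h2 h3 h4 h5 h6⟩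
  refine ⟨fun i j hij => ?_, hgen⟩
  by_contra hne
  have hcard : 1 < (Finset.univ \ {i, j} : Finset (Fin n)).card := by
    have := Finset.le_card_sdiff {i, j} (Finset.univ : Finset (Fin n))
    have h2 := Finset.card_le_two (a := i) (b := j)
    simp only [Finset.card_univ, Fintype.card_fin] at this
    omega
  obtain ⟨k, hk, l, hl, hkl⟩ := Finset.one_lt_card.1 hcard
  simp only [Finset.mem_sdiff, Finset.mem_univ, true_and, Finset.mem_insert,
    Finset.mem_singleton, not_or] at hk hl
  refine (hgen i j k l hne (Ne.symm hk.1) (Ne.symm hl.1) (Ne.symm hk.2) (Ne.symm hl.2) hkl).1 ?_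
  rw [hij, orient_self]

lemma measurableSet_holeEvent {n : ℕ} (e : Fin 4 ↪ Fin n) : MeasurableSet (holeEvent e) := by
  have hm : ∀ i : Fin n, Measurable fun z : Fin n → Euc 2 => z i := measurable_pi_apply
  have : holeEvent e = {x | IsLongBaseQuad (x (e 0)) (x (e 1)) (x (e 2)) (x (e 3))} ∩
      ⋂ m, ⋂ (_ : m ∉ Set.range e),
        {x | x m ∈ quadInterior (x (e 0)) (x (e 1)) (x (e 2)) (x (e 3))}ᶜ := by
    ext x; simp [holeEvent]
  rw [this]
  refine (measurableSet_isLongBaseQuad (hm _) (hm _) (hm _) (hm _)).inter ?_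
  exact MeasurableSet.iInter fun m => MeasurableSet.iInter fun _ =>
    (measurableSet_mem_quadInterior (hm _) (hm _) (hm _) (hm _) (hm m)).compl

open Classical in
lemma measure_holeEvent {n : ℕ} (μ : Measure (Euc 2)) [IsProbabilityMeasure μ]
    (e : Fin 4 ↪ Fin n) :
    (Measure.pi fun _ => μ) (holeEvent e) = ∫⁻ a, ∫⁻ b, ∫⁻ c, ∫⁻ d,
      (if IsLongBaseQuad a b c d then μ (quadInterior a b c d)ᶜ ^ (n - 4) else 0)
        ∂μ ∂μ ∂μ ∂μ := by
  have hz : ∀ i : Fin 4, Measurable fun w : (Fin 4 → Euc 2) × ({m // m ∉ Set.range e} → Euc 2) =>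
      w.1 i := fun i => (measurable_pi_apply i).comp measurable_fst
  let B : Set ((Fin 4 → Euc 2) × ({m // m ∉ Set.range e} → Euc 2)) :=
    {w | IsLongBaseQuad (w.1 0) (w.1 1) (w.1 2) (w.1 3)} ∩
      ⋂ m, {w | w.2 m ∈ quadInterior (w.1 0) (w.1 1) (w.1 2) (w.1 3)}ᶜ
  have hB : MeasurableSet B :=
    (measurableSet_isLongBaseQuad (hz _) (hz _) (hz _) (hz _)).inter <|
      MeasurableSet.iInter fun m => (measurableSet_mem_quadInterior (hz _) (hz _) (hz _) (hz _)
        ((measurable_pi_apply m).comp measurable_snd)).compl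
  have hpre : holeEvent e = (fun x : Fin n → Euc 2 =>
      ((fun i => x (e i)), fun m : {m // m ∉ Set.range e} => x m)) ⁻¹' B := by
    ext x
    simp [holeEvent, B]
  have hcard : Fintype.card {m // m ∉ Set.range e} = n - 4 := by
    rw [Fintype.card_subtype_compl, Fintype.card_fin,
      ← Fintype.card_congr (Equiv.ofInjective e e.injective), Fintype.card_fin]
  have hsec : ∀ z : Fin 4 → Euc 2, (Measure.pi fun _ => μ) (Prod.mk z ⁻¹' B)
      = if IsLongBaseQuad (z 0) (z 1) (z 2) (z 3) then
        μ (quadInterior (z 0) (z 1) (z 2) (z 3))ᶜ ^ (n - 4) else 0 := by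
    intro z
    split_ifs with hq
    · have : Prod.mk z ⁻¹' B
          = Set.univ.pi fun _ => (quadInterior (z 0) (z 1) (z 2) (z 3))ᶜ := by
        ext y
        simp [B, hq]
      rw [this, Measure.pi_pi]
      simp [← hcard]
    · have : Prod.mk z ⁻¹' B = ∅ := by
        ext y
        simp [B, hq]
      simp [this]
  rw [hpre, (measurePreserving_split μ e).measure_preimage hB.nullMeasurableSet,
    Measure.prod_apply hB, lintegral_pi_four μ (measurable_measure_prodMk_left hB)]
  simp only [hsec]
  rfl

/-- The expected edge-hole count is the number of ordered index quadruples times the probability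
that a given quadruple spans such a hole. -/
lemma EHedge_eq {n : ℕ} (hn : 4 ≤ n) {K : Set (Euc 2)} [IsProbabilityMeasure (unif K)] {r : ENNReal}
    (hμ : unif K ≪ volume)
    (hr : ∀ e : Fin 4 ↪ Fin n, (Measure.pi fun _ => unif K) (holeEvent e) = r) :
    EHedge K n = (n.descFactorial 4 : ℝ) * r.toReal := by
  classical
  unfold EHedge
  have hae : (fun x : Fin n → Euc 2 => (holeCountEdge n x : ℝ))
      =ᵐ[Measure.pi fun _ => unif K]
      fun x => ∑ e : Fin 4 ↪ Fin n, (holeEvent e).indicator (1 : (Fin n → Euc 2) → ℝ) x := by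
    filter_upwards [ae_isGenericSample hn hμ] with x hx
    rw [holeCountEdge_eq_card hx, Finset.card_filter]
    push_cast
    simp [Set.indicator_apply]
  rw [integral_congr_ae hae, integral_finsetSum]
  · simp only [integral_indicator_one (measurableSet_holeEvent _), Measure.real, hr]
    simp [Fintype.card_embedding_eq]
  · intro e _
    exact (integrable_const (1 : ℝ)).indicator (measurableSet_holeEvent e)

/-- Change of variables to the affine frame `p₀, v, w`. -/
lemma lintegral_affine_frame (p₀ v w : Euc 2) (hD : v 0 * w 1 - w 0 * v 1 ≠ 0)
    {f : Euc 2 → ENNReal} (hf : Measurable f) :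
    ∫⁻ p, f p = ENNReal.ofReal |v 0 * w 1 - w 0 * v 1| *
      ∫⁻ q : ℝ × ℝ, f (p₀ + q.1 • v + q.2 • w) := by
  let M : Matrix (Fin 2) (Fin 2) ℝ := !![v 0, w 0; v 1, w 1]
  have hdet : M.det = v 0 * w 1 - w 0 * v 1 := Matrix.det_fin_two_of _ _ _ _
  have hM : M.det ≠ 0 := by rwa [hdet]
  have hto : Measurable (WithLp.toLp 2 : (Fin 2 → ℝ) → Euc 2) :=
    (PiLp.volume_preserving_toLp (Fin 2)).measurable
  have hg : Measurable fun z : Fin 2 → ℝ => f (p₀ + WithLp.toLp 2 z) :=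
    hf.comp (measurable_const.add hto)
  have h1 : ∫⁻ p, f p = ∫⁻ z : Fin 2 → ℝ, f (p₀ + WithLp.toLp 2 z) := by
    rw [← lintegral_add_left_eq_self f p₀]
    exact ((PiLp.volume_preserving_toLp (Fin 2)).lintegral_comp
      (hf.comp (measurable_const_add p₀))).symm
  have hlin : Measurable (Matrix.toLin' M) :=
    (LinearMap.continuous_of_finiteDimensional _).measurable
  have h2 := lintegral_map (μ := (volume : Measure (Fin 2 → ℝ))) hg hlin
  rw [Real.map_matrix_volume_pi_eq_smul_volume_pi hM, lintegral_smul_measure] at h2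
  have h3 : ∫⁻ z : Fin 2 → ℝ, f (p₀ + WithLp.toLp 2 (Matrix.toLin' M z))
      = ∫⁻ q : ℝ × ℝ, f (p₀ + q.1 • v + q.2 • w) := by
    refine ((volume_preserving_finTwoArrow ℝ).symm.lintegral_comp (hg.comp hlin)).symm.trans
      (lintegral_congr fun q => ?_)
    simp only [Function.comp_apply]
    congr 1
    ext i
    fin_cases i <;>
      simp [M, MeasurableEquiv.finTwoArrow] <;> ring
  rw [h1, ← h3, ← h2, ← hdet, smul_eq_mul, ← mul_assoc,
    ← ENNReal.ofReal_mul (abs_nonneg _), ← abs_mul, mul_inv_cancel₀ hM]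
  simp

lemma volume_unit_triangle :
    volume {q : ℝ × ℝ | 0 < q.2 ∧ 0 < 1 - q.1 - q.2 ∧ 0 < q.1} = ENNReal.ofReal (1 / 2) := by
  have : {q : ℝ × ℝ | 0 < q.2 ∧ 0 < 1 - q.1 - q.2 ∧ 0 < q.1}
      = regionBetween (fun _ : ℝ => (0 : ℝ)) (fun x => 1 - x) (Set.Ioc 0 1) := by
    ext q
    simp only [regionBetween, Set.mem_ofPred_eq, Set.mem_Ioo, Set.mem_Ioc]
    grind
  rw [this, Measure.volume_eq_prod, volume_regionBetween_eq_integral]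
  · congr 1
    rw [← intervalIntegral.integral_of_le zero_le_one]
    simp only [Pi.sub_apply, sub_zero]
    rw [intervalIntegral.integral_sub (by simp) (by simp)]
    norm_num
  · exact integrableOn_const (by simp)
  · exact (continuous_const.sub continuous_id).continuousOn.integrableOn_Icc.mono_set
      Set.Ioc_subset_Icc_self
  · exact measurableSet_Ioc
  · intro x hx; simpa using hx.2

/-- The open region to the left of the three directed sides of `a b c`. -/
def triInterior (a b c : Euc 2) : Set (Euc 2) :=
  {p | 0 < orient a b p ∧ 0 < orient b c p ∧ 0 < orient c a p}

lemma measurableSet_orient_pos (a b : Euc 2) : MeasurableSet {p | 0 < orient a b p} :=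
  measurableSet_lt measurable_const (continuous_orient_right a b).measurable

lemma measurableSet_triInterior (a b c : Euc 2) : MeasurableSet (triInterior a b c) :=
  (measurableSet_orient_pos a b).inter
    ((measurableSet_orient_pos b c).inter (measurableSet_orient_pos c a))

lemma volume_triInterior {a b c : Euc 2} (h : 0 < orient a b c) :
    volume (triInterior a b c) = ENNReal.ofReal (orient a b c / 2) := by
  have hD : (b - a) 0 * (c - a) 1 - (c - a) 0 * (b - a) 1 = orient a b c := by
    simp [orient]; ring
  have hmeas := measurableSet_triInterior a b c
  rw [← lintegral_indicator_one hmeas,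
    lintegral_affine_frame a (b - a) (c - a) (by rw [hD]; exact h.ne')
      (measurable_one.indicator hmeas), hD, abs_of_pos h]
  have hset : ∀ q : ℝ × ℝ, (triInterior a b c).indicator (1 : Euc 2 → ENNReal)
      (a + q.1 • (b - a) + q.2 • (c - a)) =
      {q : ℝ × ℝ | 0 < q.2 ∧ 0 < 1 - q.1 - q.2 ∧ 0 < q.1}.indicator 1 q := by
    intro q
    have e1 : orient a b (a + q.1 • (b - a) + q.2 • (c - a)) = q.2 * orient a b c := by
      simp [orient]; ring
    have e2 : orient b c (a + q.1 • (b - a) + q.2 • (c - a))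
        = (1 - q.1 - q.2) * orient a b c := by
      simp [orient]; ring
    have e3 : orient c a (a + q.1 • (b - a) + q.2 • (c - a)) = q.1 * orient a b c := by
      simp [orient]; ring
    have : a + q.1 • (b - a) + q.2 • (c - a) ∈ triInterior a b c ↔
        q ∈ {q : ℝ × ℝ | 0 < q.2 ∧ 0 < 1 - q.1 - q.2 ∧ 0 < q.1} := by
      simp only [triInterior, Set.mem_ofPred_eq, e1, e2, e3, mul_pos_iff_of_pos_right h]
    by_cases hq : q ∈ {q : ℝ × ℝ | 0 < q.2 ∧ 0 < 1 - q.1 - q.2 ∧ 0 < q.1}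
    · rw [Set.indicator_of_mem hq, Set.indicator_of_mem (this.2 hq)]; rfl
    · rw [Set.indicator_of_notMem hq, Set.indicator_of_notMem (fun h' => hq (this.1 h'))]
  simp only [hset]
  rw [lintegral_indicator_one, volume_unit_triangle, ← ENNReal.ofReal_mul h.le]
  · congr 1; ring
  · have m1 : Measurable fun q : ℝ × ℝ => q.1 := measurable_fst
    have m2 : Measurable fun q : ℝ × ℝ => q.2 := measurable_snd
    exact (measurableSet_lt measurable_const m2).inter
      ((measurableSet_lt measurable_const ((measurable_const.sub m1).sub m2)).inter
        (measurableSet_lt measurable_const m1))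

lemma volume_quadInterior {a b c d : Euc 2} (h : IsLongBaseQuad a b c d) :
    volume (quadInterior a b c d) = ENNReal.ofReal ((orient a b c + orient a c d) / 2) := by
  have hac := h.ne.2.1
  obtain ⟨⟨h1, h2, h3, h4⟩, -⟩ := h
  have k1 : 0 < orient b c d := h4
  have r1 := orient_rotate c d a
  have r2 := orient_rotate a c d
  have r3 := orient_rotate b c d
  have r4 := orient_rotate a b d
  have r5 := orient_rotate d a b
  have r6 := orient_rotate b c a
  have s : ∀ p, orient c a p = - orient a c p := fun p => orient_swap_left a c p
  have hsub1 : triInterior a b c ⊆ quadInterior a b c d := by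
    rintro p ⟨p1, p2, p3⟩
    refine ⟨p1, p2, ?_, ?_⟩
    · have e : orient a b c * orient c d p
          = orient b c p * orient a c d + orient c a p * orient b c d := by
        simp [orient]; ring
      refine (mul_pos_iff_of_pos_left h1).1 ?_
      rw [e]; positivity
    · have e : orient a b c * orient d a p
          = orient c a p * orient a b d + orient a b p * orient a c d := by
        simp [orient]; ring
      refine (mul_pos_iff_of_pos_left h1).1 ?_
      rw [e]; positivity
  have hsub2 : triInterior a c d ⊆ quadInterior a b c d := by
    rintro p ⟨p1, p2, p3⟩
    refine ⟨?_, ?_, p2, p3⟩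
    · have e : orient a c d * orient a b p
          = orient d a p * orient a b c + orient a c p * orient a b d := by
        simp [orient]; ring
      refine (mul_pos_iff_of_pos_left h3).1 ?_
      rw [e]; positivity
    · have e : orient a c d * orient b c p
          = orient c d p * orient a b c + orient a c p * orient b c d := by
        simp [orient]; ring
      refine (mul_pos_iff_of_pos_left h3).1 ?_
      rw [e]; positivity
  have hdisj : Disjoint (triInterior a b c) (triInterior a c d) := by
    rw [Set.disjoint_left]
    rintro p ⟨-, -, p3⟩ ⟨p4, -, -⟩
    linarith [s p]
  have hunion : quadInterior a b c d =ᵐ[volume]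
      (triInterior a b c ∪ triInterior a c d : Set (Euc 2)) := by
    refine Filter.EventuallyEq.symm (Filter.EventuallyLE.antisymm
      (Filter.Eventually.of_forall (Set.union_subset hsub1 hsub2)) ?_)
    have h0 : ∀ᵐ p : Euc 2, orient a c p ≠ 0 :=
      compl_mem_ae_iff.2 (volume_orient_eq_zero hac)
    filter_upwards [h0] with p hp hq
    obtain ⟨p1, p2, p3, p4⟩ := hq
    rcases lt_or_gt_of_ne hp with hs | hs
    · exact Or.inl ⟨p1, p2, by linarith [s p]⟩
    · exact Or.inr ⟨hs, p3, p4⟩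
  rw [measure_congr hunion, measure_union hdisj (measurableSet_triInterior _ _ _),
    volume_triInterior h1, volume_triInterior h3, ← ENNReal.ofReal_add (by linarith) (by linarith)]
  congr 1; ring

lemma lintegral_Ioo_ofReal_eq_sub {F f : ℝ → ℝ} {A B : ℝ} (hAB : A ≤ B)
    (hF : ∀ x, HasDerivAt F (f x) x) (hf : Continuous f) (h0 : ∀ x ∈ Set.Ioo A B, 0 ≤ f x) :
    ∫⁻ x in Set.Ioo A B, ENNReal.ofReal (f x) = ENNReal.ofReal (F B - F A) := by
  rw [← ofReal_integral_eq_lintegral_ofReal, ← integral_Ioc_eq_integral_Ioo,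
    ← intervalIntegral.integral_of_le hAB,
    intervalIntegral.integral_eq_sub_of_hasDerivAt (fun x _ => hF x) (hf.intervalIntegrable _ _)]
  · exact hf.continuousOn.integrableOn_Icc.mono_set Set.Ioo_subset_Icc_self
  · exact (ae_restrict_iff' measurableSet_Ioo).2 (ae_of_all _ h0)

lemma lintegral_exp_affine_Ioo {α β A B : ℝ} (hα : 0 < α) (hAB : A ≤ B) :
    ∫⁻ s in Set.Ioo A B, ENNReal.ofReal (Real.exp (-(α * s + β)))
      = ENNReal.ofReal ((Real.exp (-(α * A + β)) - Real.exp (-(α * B + β))) / α) := by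
  rw [lintegral_Ioo_ofReal_eq_sub (F := fun s => -Real.exp (-(α * s + β)) / α) hAB]
  · congr 1; ring
  · intro x
    have h1 : HasDerivAt (fun s : ℝ => -(α * s + β)) (-α) x := by
      have := (((hasDerivAt_id x).const_mul α).add_const β).neg
      rwa [mul_one] at this
    convert! (h1.exp.neg.div_const α) using 1
    field_simp
  · fun_prop
  · intro x _; positivity

lemma lintegral_exp_sub_exp_Ioi {C p q : ℝ} (hC : 0 ≤ C) (hp : 0 < p) (hpq : p ≤ q) :
    ∫⁻ t in Set.Ioi (0 : ℝ), ENNReal.ofReal (C * (Real.exp (-p * t) - Real.exp (-q * t)))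
      = ENNReal.ofReal (C * (1 / p - 1 / q)) := by
  have i1 := integrableOn_exp_mul_Ioi (a := -p) (by linarith) 0
  have i2 := integrableOn_exp_mul_Ioi (a := -q) (by linarith) 0
  rw [← ofReal_integral_eq_lintegral_ofReal]
  · rw [integral_const_mul, integral_sub i1 i2, integral_exp_mul_Ioi (by linarith),
      integral_exp_mul_Ioi (by linarith)]
    simp
  · exact (i1.sub i2).const_mul C
  · refine (ae_restrict_iff' measurableSet_Ioi).2 (ae_of_all _ fun t ht => ?_)
    have : Real.exp (-q * t) ≤ Real.exp (-p * t) :=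
      Real.exp_le_exp.2 (by have : 0 < t := ht; nlinarith)
    exact mul_nonneg hC (sub_nonneg.2 this)

/-- In rescaled coordinates `(0,0), (1,0), (x,s), (y,t)` with `0 < y < x < 1`, the two upper
vertices complete the base to a counterclockwise convex quadrilateral. -/
def InConvexCone (w : (ℝ × ℝ) × (ℝ × ℝ)) : Prop :=
  (0 < w.2.1 ∧ w.2.1 < w.1.1 ∧ w.1.1 < 1) ∧ 0 < w.1.2 ∧ 0 < w.2.2 ∧
    0 < w.1.1 * w.2.2 - w.1.2 * w.2.1 ∧ 0 < (1 - w.2.1) * w.1.2 - (1 - w.1.1) * w.2.2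

/-- The rescaled area of the quadrilateral. -/
noncomputable def coneArea (w : (ℝ × ℝ) × (ℝ × ℝ)) : ℝ :=
  (w.1.2 * (1 - w.2.1) + w.1.1 * w.2.2) / 2

lemma continuous_coneArea : Continuous coneArea := by unfold coneArea; fun_prop

lemma measurableSet_inConvexCone : MeasurableSet {w | InConvexCone w} := by
  have h : ∀ {f g : (ℝ × ℝ) × (ℝ × ℝ) → ℝ}, Continuous f → Continuous g →
      MeasurableSet {w | f w < g w} :=
    fun hf hg => measurableSet_lt hf.measurable hg.measurable
  refine MeasurableSet.inter (MeasurableSet.inter (h ?_ ?_) (MeasurableSet.inter (h ?_ ?_)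
    (h ?_ ?_))) (MeasurableSet.inter (h ?_ ?_) (MeasurableSet.inter (h ?_ ?_)
    (MeasurableSet.inter (h ?_ ?_) (h ?_ ?_)))) <;> fun_prop

open Classical in
/-- The exponential weight with rate `κ` on the cone of convex quadrilaterals. -/
noncomputable def coneWeight (κ : ℝ) (w : (ℝ × ℝ) × (ℝ × ℝ)) : ENNReal :=
  if InConvexCone w then ENNReal.ofReal (Real.exp (-(κ * coneArea w))) else 0

lemma measurable_coneWeight (κ : ℝ) : Measurable (coneWeight κ) := by
  classical
  refine Measurable.ite measurableSet_inConvexCone ?_ measurable_const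
  exact ENNReal.measurable_ofReal.comp
    (Real.measurable_exp.comp ((continuous_coneArea.measurable.const_mul κ).neg))

lemma lintegral_coneWeight_height {κ : ℝ} (hκ : 0 < κ) {x y t : ℝ} (hy : 0 < y) (hyx : y < x)
    (hx : x < 1) (ht : 0 < t) :
    ∫⁻ s, coneWeight κ ((x, s), (y, t)) = ENNReal.ofReal (2 / (κ * (1 - y)) *
      (Real.exp (-(κ / 2) * t) - Real.exp (-(κ * x / (2 * y)) * t))) := by
  have h1y : 0 < 1 - y := by linarith
  have h1x : 0 < 1 - x := by linarith
  have hx0 : 0 < x := by linarith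
  have hind : ∀ s, coneWeight κ ((x, s), (y, t)) =
      (Set.Ioo ((1 - x) * t / (1 - y)) (x * t / y)).indicator
        (fun s => ENNReal.ofReal (Real.exp (-(κ * (1 - y) / 2 * s + κ * x * t / 2)))) s := by
    intro s
    have hiff : InConvexCone ((x, s), (y, t)) ↔
        s ∈ Set.Ioo ((1 - x) * t / (1 - y)) (x * t / y) := by
      simp only [InConvexCone, Set.mem_Ioo, div_lt_iff₀ h1y, lt_div_iff₀ hy]
      constructor
      · rintro ⟨-, -, -, h1, h2⟩
        constructor <;> linarith
      · rintro ⟨h1, h2⟩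
        refine ⟨⟨hy, hyx, hx⟩, ?_, ht, by linarith, by linarith⟩
        have : 0 < s * (1 - y) := lt_trans (mul_pos h1x ht) h1
        exact (mul_pos_iff_of_pos_right h1y).1 this
    unfold coneWeight
    split_ifs with h
    · rw [Set.indicator_of_mem (hiff.1 h)]
      congr 3
      simp only [coneArea]; ring
    · rw [Set.indicator_of_notMem (fun h' => h (hiff.2 h'))]
  simp only [hind]
  rw [lintegral_indicator measurableSet_Ioo, lintegral_exp_affine_Ioo (by positivity)]
  · congr 1
    have e1 : κ * (1 - y) / 2 * ((1 - x) * t / (1 - y)) + κ * x * t / 2 = κ / 2 * t := by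
      field_simp; ring
    have e2 : κ * (1 - y) / 2 * (x * t / y) + κ * x * t / 2 = κ * x / (2 * y) * t := by
      field_simp; ring
    rw [e1, e2, neg_mul, neg_mul]
    field_simp
  · rw [div_le_div_iff₀ h1y hy]
    nlinarith

lemma lintegral_coneWeight_heights {κ : ℝ} (hκ : 0 < κ) (x y : ℝ) :
    ∫⁻ t, ∫⁻ s, coneWeight κ ((x, s), (y, t)) = (Set.Ioo 0 1).indicator (fun x =>
      (Set.Ioo 0 x).indicator (fun y =>
        ENNReal.ofReal (4 / κ ^ 2) * ENNReal.ofReal ((x - y) / (x * (1 - y)))) y) x := by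
  by_cases h : 0 < y ∧ y < x ∧ x < 1
  · obtain ⟨hy, hyx, hx⟩ := h
    have h1y : 0 < 1 - y := by linarith
    have hx0 : 0 < x := by linarith
    rw [Set.indicator_of_mem (Set.mem_Ioo.2 ⟨hx0, hx⟩),
      Set.indicator_of_mem (Set.mem_Ioo.2 ⟨hy, hyx⟩)]
    have hind : ∀ t, ∫⁻ s, coneWeight κ ((x, s), (y, t)) = (Set.Ioi (0 : ℝ)).indicator
        (fun t => ENNReal.ofReal (2 / (κ * (1 - y)) *
          (Real.exp (-(κ / 2) * t) - Real.exp (-(κ * x / (2 * y)) * t)))) t := by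
      intro t
      by_cases ht : 0 < t
      · rw [Set.indicator_of_mem (Set.mem_Ioi.2 ht), lintegral_coneWeight_height hκ hy hyx hx ht]
      · rw [Set.indicator_of_notMem (by simpa using ht)]
        simp [coneWeight, InConvexCone, ht]
    simp only [hind]
    rw [lintegral_indicator measurableSet_Ioi,
      lintegral_exp_sub_exp_Ioi (by positivity) (by positivity),
      ← ENNReal.ofReal_mul (by positivity)]
    · congr 1
      field_simp
      ring
    · rw [div_le_div_iff₀ (by norm_num) (by positivity)]
      nlinarith
  · have hz : ∀ t s, coneWeight κ ((x, s), (y, t)) = 0 := by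
      intro t s
      simp only [coneWeight, InConvexCone, h, false_and, if_false]
    simp only [hz, lintegral_zero]
    symm
    simp only [Set.indicator_apply, Set.mem_Ioo]
    split_ifs <;> grind

lemma hasSum_one_div_succ_mul_sq :
    HasSum (fun k : ℕ => 1 / (((k : ℝ) + 1) * ((k : ℝ) + 2) ^ 2)) (2 - Real.pi ^ 2 / 6) := by
  have h1 : HasSum (fun k : ℕ => 1 / (((k : ℝ) + 1) * ((k : ℝ) + 2))) 1 := by
    rw [hasSum_iff_tendsto_nat_of_nonneg (fun k => by positivity)]
    have hs : ∀ n : ℕ, ∑ k ∈ Finset.range n, 1 / (((k : ℝ) + 1) * ((k : ℝ) + 2))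
        = 1 - 1 / ((n : ℝ) + 1) := by
      intro n
      induction n with
      | zero => simp
      | succ n ih =>
        rw [Finset.sum_range_succ, ih]
        push_cast
        field_simp
        ring
    simp only [hs]
    simpa using (tendsto_const_nhds (x := (1 : ℝ))).sub
      (tendsto_one_div_add_atTop_nhds_zero_nat (𝕜 := ℝ))
  have h2 : HasSum (fun k : ℕ => 1 / ((k : ℝ) + 2) ^ 2) (Real.pi ^ 2 / 6 - 1) := by
    have := (hasSum_nat_add_iff' (f := fun n : ℕ => 1 / (n : ℝ) ^ 2) 2).2 hasSum_zeta_two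
    simpa [Finset.sum_range_succ] using this
  convert! h1.sub h2 using 1
  · ext k
    field_simp
    ring
  · ring

lemma lintegral_ratio :
    ∫⁻ x in Set.Ioo (0 : ℝ) 1, ∫⁻ y in Set.Ioo (0 : ℝ) x,
      ENNReal.ofReal ((x - y) / (x * (1 - y))) = ENNReal.ofReal (2 - Real.pi ^ 2 / 6) := by
  have hinner : ∀ x ∈ Set.Ioo (0 : ℝ) 1, ∫⁻ y in Set.Ioo (0 : ℝ) x,
      ENNReal.ofReal ((x - y) / (x * (1 - y)))
      = ∑' k : ℕ, ENNReal.ofReal (x ^ (k + 1) * (1 / (((k : ℝ) + 1) * ((k : ℝ) + 2)))) := by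
    rintro x ⟨hx0, hx1⟩
    have hser : ∀ y ∈ Set.Ioo (0 : ℝ) x, ENNReal.ofReal ((x - y) / (x * (1 - y)))
        = ∑' k : ℕ, ENNReal.ofReal ((x - y) * y ^ k / x) := by
      rintro y ⟨hy0, hyx⟩
      have hg := (hasSum_geometric_of_lt_one hy0.le (hyx.trans hx1)).mul_left ((x - y) / x)
      rw [← ENNReal.ofReal_tsum_of_nonneg]
      · congr 1
        have e : (fun k : ℕ => (x - y) * y ^ k / x) = fun k => (x - y) / x * y ^ k := by
          ext k; ring
        rw [e, hg.tsum_eq]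
        have : 1 - y ≠ 0 := by linarith
        field_simp
      · intro k
        have : 0 ≤ x - y := by linarith
        positivity
      · convert! hg.summable using 1
        ext k; ring
    rw [setLIntegral_congr_fun measurableSet_Ioo hser, lintegral_tsum]
    · congr with k
      rw [lintegral_Ioo_ofReal_eq_sub
        (F := fun y => y ^ (k + 1) / ((k : ℝ) + 1) - y ^ (k + 2) / (((k : ℝ) + 2) * x)) hx0.le]
      · congr 1
        simp only [ne_eq, Nat.add_eq_zero_iff, one_ne_zero, and_false, not_false_eq_true, zero_pow,
          OfNat.ofNat_ne_zero, zero_div, sub_zero]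
        field_simp
        ring
      · intro y
        have d1 := (hasDerivAt_pow (k + 1) y).div_const ((k : ℝ) + 1)
        have d2 := (hasDerivAt_pow (k + 2) y).div_const (((k : ℝ) + 2) * x)
        convert! d1.sub d2 using 1
        push_cast
        field_simp
        ring
      · fun_prop
      · rintro y ⟨hy0, hyx⟩
        have : 0 ≤ x - y := by linarith
        positivity
    · intro k
      exact (ENNReal.measurable_ofReal.comp (by fun_prop)).aemeasurable
  rw [setLIntegral_congr_fun measurableSet_Ioo hinner, lintegral_tsum,
    ← hasSum_one_div_succ_mul_sq.tsum_eq, ENNReal.ofReal_tsum_of_nonneg]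
  · congr with k
    rw [lintegral_Ioo_ofReal_eq_sub
      (F := fun x => x ^ (k + 2) / ((k : ℝ) + 2) * (1 / (((k : ℝ) + 1) * ((k : ℝ) + 2))))
      zero_le_one]
    · congr 1
      simp only [ne_eq, Nat.add_eq_zero_iff, and_false, not_false_eq_true, zero_pow,
        OfNat.ofNat_ne_zero, zero_div, zero_mul, sub_zero, one_pow]
      field_simp
    · intro y
      have d2 := ((hasDerivAt_pow (k + 2) y).div_const ((k : ℝ) + 2)).mul_const
        (1 / (((k : ℝ) + 1) * ((k : ℝ) + 2)))
      convert! d2 using 1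
      push_cast
      field_simp
    · fun_prop
    · rintro y ⟨hy0, hyx⟩
      positivity
  · intro k; positivity
  · exact hasSum_one_div_succ_mul_sq.summable
  · intro k
    exact (ENNReal.measurable_ofReal.comp (by fun_prop)).aemeasurable

lemma lintegral_coneWeight {κ : ℝ} (hκ : 0 < κ) :
    ∫⁻ w, coneWeight κ w
      = ENNReal.ofReal (4 / κ ^ 2) * ENNReal.ofReal (2 - Real.pi ^ 2 / 6) := by
  have hm := measurable_coneWeight κ
  rw [Measure.volume_eq_prod, lintegral_prod _ hm.aemeasurable, Measure.volume_eq_prod,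
    lintegral_prod _ (hm.lintegral_prod_right').aemeasurable, ← lintegral_ratio,
    ← lintegral_const_mul', ← lintegral_indicator measurableSet_Ioo]
  · refine lintegral_congr fun x => ?_
    have hswap : ∫⁻ s, ∫⁻ q : ℝ × ℝ, coneWeight κ ((x, s), q)
        = ∫⁻ q : ℝ × ℝ, ∫⁻ s, coneWeight κ ((x, s), q) := by
      refine lintegral_lintegral_swap (Measurable.aemeasurable ?_)
      exact hm.comp (by fun_prop)
    have hx : Measurable fun w : (ℝ × ℝ) × ℝ => coneWeight κ ((x, w.2), w.1) :=
      hm.comp (by fun_prop)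
    rw [← Measure.volume_eq_prod, hswap, Measure.volume_eq_prod,
      lintegral_prod _ (hx.lintegral_prod_right').aemeasurable]
    simp only [lintegral_coneWeight_heights hκ]
    by_cases h : x ∈ Set.Ioo (0 : ℝ) 1
    · simp only [Set.indicator_of_mem h]
      rw [lintegral_indicator measurableSet_Ioo, lintegral_const_mul' _ _ ENNReal.ofReal_ne_top]
    · simp only [Set.indicator_of_notMem h, lintegral_zero]
  · exact ENNReal.ofReal_ne_top

/-- The vector at a right angle to `b - a` that spans with it a frame of determinant `r`. -/
noncomputable def heightVector (a b : Euc 2) (r : ℝ) : Euc 2 :=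
  (r / ((b 0 - a 0) ^ 2 + (b 1 - a 1) ^ 2)) • !₂[-(b 1 - a 1), b 0 - a 0]

/-- The point with coordinates `q` in the frame of determinant `r` over the base `a b`. -/
noncomputable def framePoint (a b : Euc 2) (r : ℝ) (q : ℝ × ℝ) : Euc 2 :=
  a + q.1 • (b - a) + q.2 • heightVector a b r

lemma heightVector_zero (a b : Euc 2) (r : ℝ) : heightVector a b r 0 =
    r / ((b 0 - a 0) ^ 2 + (b 1 - a 1) ^ 2) * (-(b 1 - a 1)) := by
  simp [heightVector]

lemma heightVector_one (a b : Euc 2) (r : ℝ) : heightVector a b r 1 =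
    r / ((b 0 - a 0) ^ 2 + (b 1 - a 1) ^ 2) * (b 0 - a 0) := by
  simp [heightVector]

lemma continuous_framePoint (a b : Euc 2) (r : ℝ) : Continuous (framePoint a b r) := by
  unfold framePoint; fun_prop

lemma framePoint_apply (a b : Euc 2) (r : ℝ) (q : ℝ × ℝ) (i : Fin 2) :
    framePoint a b r q i = a i + q.1 * (b i - a i) + q.2 * heightVector a b r i := by
  simp [framePoint]

lemma base_sq_pos {a b : Euc 2} (hab : a ≠ b) : 0 < (b 0 - a 0) ^ 2 + (b 1 - a 1) ^ 2 := by
  by_contra h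
  have h0 : b 0 - a 0 = 0 := by nlinarith [sq_nonneg (b 0 - a 0), sq_nonneg (b 1 - a 1)]
  have h1 : b 1 - a 1 = 0 := by nlinarith [sq_nonneg (b 0 - a 0), sq_nonneg (b 1 - a 1)]
  apply hab
  ext i
  fin_cases i
  · simp only [Fin.zero_eta]; linarith
  · simp only [Fin.mk_one]; linarith

lemma base_wedge_heightVector {a b : Euc 2} (hab : a ≠ b) (r : ℝ) :
    (b - a) 0 * heightVector a b r 1 - heightVector a b r 0 * (b - a) 1 = r := by
  have hL := base_sq_pos hab
  rw [heightVector_zero, heightVector_one, PiLp.sub_apply, PiLp.sub_apply]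
  field_simp
  ring

lemma orient_base_framePoint {a b : Euc 2} (hab : a ≠ b) (r : ℝ) (q : ℝ × ℝ) :
    orient a b (framePoint a b r q) = q.2 * r := by
  have h := base_wedge_heightVector hab r
  simp only [orient, framePoint_apply, PiLp.sub_apply] at h ⊢
  linear_combination q.2 * h

lemma orient_left_framePoint {a b : Euc 2} (hab : a ≠ b) (r : ℝ) (q q' : ℝ × ℝ) :
    orient a (framePoint a b r q) (framePoint a b r q') = (q.1 * q'.2 - q.2 * q'.1) * r := by
  have h := base_wedge_heightVector hab r
  simp only [orient, framePoint_apply, PiLp.sub_apply] at h ⊢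
  linear_combination (q.1 * q'.2 - q.2 * q'.1) * h

lemma orient_right_framePoint {a b : Euc 2} (hab : a ≠ b) (r : ℝ) (q q' : ℝ × ℝ) :
    orient b (framePoint a b r q) (framePoint a b r q')
      = ((1 - q'.1) * q.2 - (1 - q.1) * q'.2) * r := by
  have h := base_wedge_heightVector hab r
  simp only [orient, framePoint_apply, PiLp.sub_apply] at h ⊢
  linear_combination ((1 - q'.1) * q.2 - (1 - q.1) * q'.2) * h

lemma dist_sq_eq (p q : Euc 2) : dist p q ^ 2 = (q 0 - p 0) ^ 2 + (q 1 - p 1) ^ 2 := by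
  rw [EuclideanSpace.dist_eq, Real.sq_sqrt (by positivity), Fin.sum_univ_two, Real.dist_eq,
    Real.dist_eq, sq_abs, sq_abs]
  ring

/-- A point within one base length of both ends of the base projects into the open base. -/
lemma framePoint_fst_mem {a b : Euc 2} (hab : a ≠ b) {r : ℝ} (hr : 0 < r) {q : ℝ × ℝ}
    (hq : 0 < q.2) (ha : dist a (framePoint a b r q) ≤ dist a b)
    (hb : dist b (framePoint a b r q) ≤ dist a b) : 0 < q.1 ∧ q.1 < 1 := by
  have hL := base_sq_pos hab
  have key : ∀ u : ℝ, (u * (b 0 - a 0) + q.2 * heightVector a b r 0) ^ 2 +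
      (u * (b 1 - a 1) + q.2 * heightVector a b r 1) ^ 2 ≤ (b 0 - a 0) ^ 2 + (b 1 - a 1) ^ 2 →
      u ^ 2 < 1 := by
    intro u hu
    have e : (u * (b 0 - a 0) + q.2 * heightVector a b r 0) ^ 2 +
        (u * (b 1 - a 1) + q.2 * heightVector a b r 1) ^ 2
        = u ^ 2 * ((b 0 - a 0) ^ 2 + (b 1 - a 1) ^ 2) +
          q.2 ^ 2 * r ^ 2 / ((b 0 - a 0) ^ 2 + (b 1 - a 1) ^ 2) := by
      rw [heightVector_zero, heightVector_one]
      field_simp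
      ring
    have hp : 0 < q.2 ^ 2 * r ^ 2 / ((b 0 - a 0) ^ 2 + (b 1 - a 1) ^ 2) := by positivity
    rw [e] at hu
    by_contra hu1
    nlinarith
  have h1 := pow_le_pow_left₀ dist_nonneg ha 2
  have h2 := pow_le_pow_left₀ dist_nonneg hb 2
  rw [dist_sq_eq, dist_sq_eq] at h1 h2
  simp only [framePoint_apply] at h1 h2
  have k1 := key q.1 (by linarith)
  have k2 := key (q.1 - 1) (by linarith)
  constructor <;> nlinarith

lemma IsLongBaseQuad.inConvexCone {a b : Euc 2} {r : ℝ} (hr : 0 < r) {w : (ℝ × ℝ) × (ℝ × ℝ)}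
    (h : IsLongBaseQuad a b (framePoint a b r w.1) (framePoint a b r w.2)) : InConvexCone w := by
  have hab := h.ne.1
  obtain ⟨⟨h1, h2, h3, h4⟩, d1, d2, d3, d4, -⟩ := h
  rw [orient_base_framePoint hab, mul_pos_iff_of_pos_right hr] at h1 h2
  rw [orient_left_framePoint hab, mul_pos_iff_of_pos_right hr] at h3
  rw [orient_right_framePoint hab, mul_pos_iff_of_pos_right hr] at h4
  obtain ⟨x0, x1⟩ := framePoint_fst_mem hab hr h1 d1 d3
  obtain ⟨y0, y1⟩ := framePoint_fst_mem hab hr h2 d2 d4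
  refine ⟨⟨y0, ?_, x1⟩, h1, h2, h3, h4⟩
  by_contra hxy
  have hts : w.1.2 < w.2.2 := by nlinarith
  nlinarith

open Classical in
/-- The probability density that the points `c d` complete the base `a b` to an empty convex
quadrilateral in `K` with longest side `a b`, in terms of its area. -/
noncomputable def quadDensity (K : Set (Euc 2)) (m : ℕ) (a b c d : Euc 2) : ENNReal :=
  if c ∈ K ∧ d ∈ K ∧ IsLongBaseQuad a b c d then
    ENNReal.ofReal (1 - (orient a b c + orient a c d) / 2) ^ m else 0

lemma measurable_quadDensity {α : Type*} [MeasurableSpace α] {K : Set (Euc 2)}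
    (hK : MeasurableSet K) (m : ℕ) {f g h k : α → Euc 2} (hf : Measurable f) (hg : Measurable g)
    (hh : Measurable h) (hk : Measurable k) :
    Measurable fun x => quadDensity K m (f x) (g x) (h x) (k x) := by
  classical
  refine Measurable.ite ((hh hK).inter ((hk hK).inter
    (measurableSet_isLongBaseQuad hf hg hh hk))) ?_ measurable_const
  exact (ENNReal.measurable_ofReal.comp (measurable_const.sub
    (((hf.orient hg hh).add (hf.orient hh hk)).div_const 2))).pow_const m

/-- The expectation of `quadDensity` in coordinates rescaled by the factor `n`. -/
lemma lintegral_quadDensity {K : Set (Euc 2)} (hK : MeasurableSet K) (m : ℕ) {a b : Euc 2}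
    (hab : a ≠ b) {r : ℝ} (hr : 0 < r) :
    ∫⁻ c, ∫⁻ d, quadDensity K m a b c d = ENNReal.ofReal (r ^ 2) *
      ∫⁻ w : (ℝ × ℝ) × (ℝ × ℝ),
        quadDensity K m a b (framePoint a b r w.1) (framePoint a b r w.2) := by
  have hw := base_wedge_heightVector hab r
  have hframe : ∀ {f : Euc 2 → ENNReal}, Measurable f →
      ∫⁻ p, f p = ENNReal.ofReal r * ∫⁻ q : ℝ × ℝ, f (framePoint a b r q) := by
    intro f hf
    have := lintegral_affine_frame a (b - a) (heightVector a b r) (by rw [hw]; exact hr.ne') hf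
    rwa [hw, abs_of_pos hr] at this
  have hm2 : Measurable fun z : Euc 2 × Euc 2 => quadDensity K m a b z.1 z.2 :=
    measurable_quadDensity hK m measurable_const measurable_const measurable_fst measurable_snd
  have hφ := (continuous_framePoint a b r).measurable
  rw [hframe hm2.lintegral_prod_right']
  have : ∀ c, ∫⁻ d, quadDensity K m a b c d
      = ENNReal.ofReal r * ∫⁻ q : ℝ × ℝ, quadDensity K m a b c (framePoint a b r q) := fun c =>
    hframe (hm2.comp measurable_prodMk_left)
  simp only [this]
  rw [lintegral_const_mul' _ _ ENNReal.ofReal_ne_top, ← mul_assoc, ← ENNReal.ofReal_mul hr.le,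
    ← sq, Measure.volume_eq_prod (ℝ × ℝ) (ℝ × ℝ), lintegral_prod]
  exact (measurable_quadDensity hK m measurable_const measurable_const
    (hφ.comp measurable_fst) (hφ.comp measurable_snd)).aemeasurable

lemma area_framePoint {a b : Euc 2} (hab : a ≠ b) (r : ℝ) (w : (ℝ × ℝ) × (ℝ × ℝ)) :
    (orient a b (framePoint a b r w.1) +
      orient a (framePoint a b r w.1) (framePoint a b r w.2)) / 2 = coneArea w * r := by
  rw [orient_base_framePoint hab, orient_left_framePoint hab, coneArea]
  ring

lemma InConvexCone.coneArea_pos {w : (ℝ × ℝ) × (ℝ × ℝ)} (h : InConvexCone w) : 0 < coneArea w := by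
  obtain ⟨⟨h1, h2, h3⟩, h4, h5, -⟩ := h
  have : 0 < 1 - w.2.1 := by linarith
  have : 0 < w.1.1 := by linarith
  unfold coneArea
  positivity

lemma quadDensity_framePoint_le (K : Set (Euc 2)) {n : ℕ} (hn : 8 ≤ n) (a b : Euc 2)
    (w : (ℝ × ℝ) × (ℝ × ℝ)) :
    quadDensity K (n - 4) a b (framePoint a b (n : ℝ)⁻¹ w.1) (framePoint a b (n : ℝ)⁻¹ w.2)
      ≤ coneWeight (1 / 2) w := by
  have hn' : (8 : ℝ) ≤ n := by exact_mod_cast hn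
  have hn0 : (0 : ℝ) < n := by linarith
  unfold quadDensity
  split_ifs with h
  · have hc := h.2.2.inConvexCone (inv_pos.2 hn0)
    rw [coneWeight, if_pos hc, area_framePoint h.2.2.ne.1]
    have hA := hc.coneArea_pos
    calc ENNReal.ofReal (1 - coneArea w * (n : ℝ)⁻¹) ^ (n - 4)
        ≤ ENNReal.ofReal (Real.exp (-(coneArea w * (n : ℝ)⁻¹))) ^ (n - 4) := by
          gcongr
          exact Real.one_sub_le_exp_neg _
      _ = ENNReal.ofReal (Real.exp ((n - 4 : ℕ) * -(coneArea w * (n : ℝ)⁻¹))) := by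
          rw [← ENNReal.ofReal_pow (Real.exp_nonneg _), ← Real.exp_nat_mul]
      _ ≤ ENNReal.ofReal (Real.exp (-(1 / 2 * coneArea w))) := by
          apply ENNReal.ofReal_le_ofReal
          apply Real.exp_le_exp.2
          rw [Nat.cast_sub (by omega)]
          have : (1 / 2 : ℝ) ≤ ((n : ℝ) - (4 : ℕ)) * (n : ℝ)⁻¹ := by
            rw [← div_eq_mul_inv, div_le_div_iff₀ (by norm_num) hn0]
            push_cast
            linarith
          nlinarith
  · exact zero_le

lemma tendsto_one_sub_mul_inv_pow (A : ℝ) :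
    Tendsto (fun n : ℕ => ENNReal.ofReal (1 - A * (n : ℝ)⁻¹) ^ (n - 4)) atTop
      (nhds (ENNReal.ofReal (Real.exp (-A)))) := by
  have hb : Tendsto (fun n : ℕ => 1 - A * (n : ℝ)⁻¹) atTop (nhds 1) := by
    simpa using tendsto_const_nhds.sub ((tendsto_inv_atTop_nhds_zero_nat (𝕜 := ℝ)).const_mul A)
  have hlim := (Real.tendsto_one_add_div_pow_exp (-A)).div (hb.pow 4) (by norm_num)
  rw [one_pow, div_one] at hlim
  refine ((ENNReal.continuous_ofReal.tendsto _).comp hlim).congr' ?_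
  filter_upwards [hb.eventually (lt_mem_nhds one_pos), eventually_ge_atTop 4] with n hn hn4
  have e : 1 + -A / (n : ℝ) = 1 - A * (n : ℝ)⁻¹ := by rw [div_eq_mul_inv]; ring
  rw [← ENNReal.ofReal_pow hn.le]
  simp only [Function.comp_apply, Pi.div_apply, e]
  rw [pow_sub₀ _ hn.ne' hn4, div_eq_mul_inv]

lemma tendsto_framePoint (a b : Euc 2) (q : ℝ × ℝ) :
    Tendsto (fun n : ℕ => framePoint a b (n : ℝ)⁻¹ q) atTop (nhds (a + q.1 • (b - a))) := by
  have h : Continuous fun r : ℝ => framePoint a b r q := by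
    unfold framePoint heightVector
    fun_prop
  have := (h.tendsto 0).comp (tendsto_inv_atTop_nhds_zero_nat (𝕜 := ℝ))
  simpa [framePoint, heightVector, Function.comp_def] using this

lemma InConvexCone.isLongBaseQuad_eventually {K : Set (Euc 2)} (hK : Convex ℝ K) {a b : Euc 2}
    (ha : a ∈ interior K) (hb : b ∈ interior K) (hab : a ≠ b) {w : (ℝ × ℝ) × (ℝ × ℝ)}
    (hw : InConvexCone w) :
    ∀ᶠ n : ℕ in atTop, framePoint a b (n : ℝ)⁻¹ w.1 ∈ K ∧ framePoint a b (n : ℝ)⁻¹ w.2 ∈ K ∧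
      IsLongBaseQuad a b (framePoint a b (n : ℝ)⁻¹ w.1) (framePoint a b (n : ℝ)⁻¹ w.2) := by
  obtain ⟨⟨y0, yx, x1⟩, h1, h2, h3, h4⟩ := hw
  have hd : 0 < dist a b := dist_pos.2 hab
  have hmem : ∀ q : ℝ × ℝ, 0 < q.1 → q.1 < 1 →
      ∀ᶠ n : ℕ in atTop, framePoint a b (n : ℝ)⁻¹ q ∈ K := by
    intro q q0 q1
    refine ((tendsto_framePoint a b q).eventually (isOpen_interior.mem_nhds ?_)).mono
      fun n hn => interior_subset hn
    exact hK.interior.add_smul_sub_mem ha hb ⟨q0.le, q1.le⟩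
  have hda : ∀ q : ℝ × ℝ, 0 < q.1 → q.1 < 1 →
      ∀ᶠ n : ℕ in atTop, dist a (framePoint a b (n : ℝ)⁻¹ q) ≤ dist a b := by
    intro q q0 q1
    refine ((tendsto_const_nhds.dist (tendsto_framePoint a b q)).eventually
      (gt_mem_nhds ?_)).mono fun n hn => hn.le
    rw [dist_self_add_right, norm_smul, ← dist_eq_norm, dist_comm b a, Real.norm_of_nonneg q0.le]
    nlinarith
  have hdb : ∀ q : ℝ × ℝ, 0 < q.1 → q.1 < 1 →
      ∀ᶠ n : ℕ in atTop, dist b (framePoint a b (n : ℝ)⁻¹ q) ≤ dist a b := by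
    intro q q0 q1
    refine ((tendsto_const_nhds.dist (tendsto_framePoint a b q)).eventually
      (gt_mem_nhds ?_)).mono fun n hn => hn.le
    have e : b - (a + q.1 • (b - a)) = (1 - q.1) • (b - a) := by module
    rw [dist_eq_norm, e, norm_smul, ← dist_eq_norm b a, dist_comm b a,
      Real.norm_of_nonneg (by linarith)]
    nlinarith
  have hdcd : ∀ᶠ n : ℕ in atTop, dist (framePoint a b (n : ℝ)⁻¹ w.1)
      (framePoint a b (n : ℝ)⁻¹ w.2) ≤ dist a b := by
    refine (((tendsto_framePoint a b w.1).dist (tendsto_framePoint a b w.2)).eventually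
      (gt_mem_nhds ?_)).mono fun n hn => hn.le
    have e : (a + w.1.1 • (b - a)) - (a + w.2.1 • (b - a)) = (w.1.1 - w.2.1) • (b - a) := by module
    rw [dist_eq_norm, e, norm_smul, ← dist_eq_norm b a, dist_comm b a,
      Real.norm_of_nonneg (by linarith)]
    nlinarith
  have x0 := y0.trans yx
  have y1 := yx.trans x1
  filter_upwards [hmem w.1 x0 x1, hmem w.2 y0 y1, hda w.1 x0 x1, hda w.2 y0 y1, hdb w.1 x0 x1,
    hdb w.2 y0 y1, hdcd, eventually_gt_atTop 0] with n m1 m2 d1 d2 d3 d4 d5 hn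
  have hr : (0 : ℝ) < (n : ℝ)⁻¹ := by positivity
  refine ⟨m1, m2, ⟨?_, ?_, ?_, ?_⟩, d1, d2, d3, d4, d5⟩
  · rw [orient_base_framePoint hab]; positivity
  · rw [orient_base_framePoint hab]; positivity
  · rw [orient_left_framePoint hab]; positivity
  · rw [orient_right_framePoint hab]; positivity

lemma tendsto_quadDensity_framePoint {K : Set (Euc 2)} (hK : Convex ℝ K) {a b : Euc 2}
    (ha : a ∈ interior K) (hb : b ∈ interior K) (hab : a ≠ b) (w : (ℝ × ℝ) × (ℝ × ℝ)) :
    Tendsto (fun n : ℕ => quadDensity K (n - 4) a b (framePoint a b (n : ℝ)⁻¹ w.1)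
      (framePoint a b (n : ℝ)⁻¹ w.2)) atTop (nhds (coneWeight 1 w)) := by
  unfold coneWeight
  split_ifs with hw
  · rw [one_mul]
    refine (tendsto_one_sub_mul_inv_pow (coneArea w)).congr' ?_
    filter_upwards [hw.isLongBaseQuad_eventually hK ha hb hab] with n hn
    rw [quadDensity, if_pos hn, area_framePoint hab]
  · refine tendsto_const_nhds.congr' ?_
    filter_upwards [eventually_gt_atTop 0] with n hn
    rw [quadDensity, if_neg]
    exact fun h => hw (h.2.2.inConvexCone (by positivity))

/-- The expected number, over the base `a b`, of completions to an empty quadrilateral, in the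
normalization by `n ^ 2`. -/
noncomputable def baseWeight (K : Set (Euc 2)) (n : ℕ) (a b : Euc 2) : ENNReal :=
  ENNReal.ofReal ((n : ℝ) ^ 2) * ∫⁻ c, ∫⁻ d, quadDensity K (n - 4) a b c d

lemma baseWeight_eq {K : Set (Euc 2)} (hK : MeasurableSet K) {n : ℕ} (hn : 0 < n) {a b : Euc 2}
    (hab : a ≠ b) : baseWeight K n a b = ∫⁻ w : (ℝ × ℝ) × (ℝ × ℝ),
      quadDensity K (n - 4) a b (framePoint a b (n : ℝ)⁻¹ w.1) (framePoint a b (n : ℝ)⁻¹ w.2) := by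
  have hn0 : (0 : ℝ) < n := by exact_mod_cast hn
  rw [baseWeight, lintegral_quadDensity hK (n - 4) hab (inv_pos.2 hn0), ← mul_assoc,
    ← ENNReal.ofReal_mul (by positivity), inv_pow, mul_inv_cancel₀ (by positivity),
    ENNReal.ofReal_one, one_mul]

lemma baseWeight_le {K : Set (Euc 2)} (hK : MeasurableSet K) {n : ℕ} (hn : 8 ≤ n) (a b : Euc 2) :
    baseWeight K n a b ≤ ∫⁻ w, coneWeight (1 / 2) w := by
  rcases eq_or_ne a b with rfl | hab
  · have : ∀ c d, quadDensity K (n - 4) a a c d = 0 := fun c d =>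
      if_neg fun h => h.2.2.ne.1 rfl
    simp [baseWeight, this]
  · rw [baseWeight_eq hK (by omega) hab]
    exact lintegral_mono fun w => quadDensity_framePoint_le K hn a b w

lemma tendsto_baseWeight {K : Set (Euc 2)} (hK : Convex ℝ K) (hKm : MeasurableSet K)
    {a b : Euc 2} (ha : a ∈ interior K) (hb : b ∈ interior K) (hab : a ≠ b) :
    Tendsto (fun n : ℕ => baseWeight K n a b) atTop (nhds (∫⁻ w, coneWeight 1 w)) := by
  have : Tendsto (fun n : ℕ => ∫⁻ w : (ℝ × ℝ) × (ℝ × ℝ), quadDensity K (n - 4) a b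
      (framePoint a b (n : ℝ)⁻¹ w.1) (framePoint a b (n : ℝ)⁻¹ w.2)) atTop
      (nhds (∫⁻ w, coneWeight 1 w)) := by
    refine tendsto_lintegral_filter_of_dominated_convergence (coneWeight (1 / 2))
      (Eventually.of_forall fun n => ?_) ?_ ?_
      (ae_of_all _ (tendsto_quadDensity_framePoint hK ha hb hab))
    · have hφ := (continuous_framePoint a b (n : ℝ)⁻¹).measurable
      exact measurable_quadDensity hKm _ measurable_const measurable_const
        (hφ.comp measurable_fst) (hφ.comp measurable_snd)
    · filter_upwards [eventually_ge_atTop 8] with n hn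
      exact ae_of_all _ (quadDensity_framePoint_le K hn a b)
    · rw [lintegral_coneWeight (by norm_num)]
      exact ENNReal.mul_ne_top ENNReal.ofReal_ne_top ENNReal.ofReal_ne_top
  refine this.congr' ?_
  filter_upwards [eventually_gt_atTop 0] with n hn
  rw [baseWeight_eq hKm hn hab]

lemma measurable_baseWeight {K : Set (Euc 2)} (hK : MeasurableSet K) (n : ℕ) :
    Measurable fun z : Euc 2 × Euc 2 => baseWeight K n z.1 z.2 := by
  have h : Measurable fun z : ((Euc 2 × Euc 2) × Euc 2) × Euc 2 =>
      quadDensity K (n - 4) z.1.1.1 z.1.1.2 z.1.2 z.2 :=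
    measurable_quadDensity hK _ (by fun_prop) (by fun_prop) (by fun_prop) (by fun_prop)
  exact h.lintegral_prod_right'.lintegral_prod_right'.const_mul _

lemma tendsto_lintegral_baseWeight {K : Set (Euc 2)} (hK : IsConvexBody K) (hvol : volume K = 1) :
    Tendsto (fun n : ℕ => ∫⁻ a in K, ∫⁻ b in K, baseWeight K n a b) atTop
      (nhds (∫⁻ w, coneWeight 1 w)) := by
  have hKm : MeasurableSet K := hK.2.1.isClosed.measurableSet
  have hμ : (volume.restrict K) Set.univ = 1 := by rw [Measure.restrict_apply_univ, hvol]
  have hfin : ∫⁻ w, coneWeight (1 / 2) w ≠ ⊤ := by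
    rw [lintegral_coneWeight (by norm_num)]
    exact ENNReal.mul_ne_top ENNReal.ofReal_ne_top ENNReal.ofReal_ne_top
  have hconst : ∀ c : ENNReal, ∫⁻ _ in K, c = c := fun c => by
    rw [lintegral_const, hμ, mul_one]
  have hint : ∀ᵐ a ∂volume.restrict K, a ∈ interior K := by
    rw [ae_restrict_iff' hKm]
    have hf : ∀ᵐ a ∂(volume : Measure (Euc 2)), a ∉ frontier K :=
      measure_eq_zero_iff_ae_notMem.1 (hK.1.addHaar_frontier volume)
    filter_upwards [hf] with a ha haK
    by_contra h
    exact ha ⟨subset_closure haK, h⟩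
  have hinner : ∀ a ∈ interior K, Tendsto (fun n : ℕ => ∫⁻ b in K, baseWeight K n a b) atTop
      (nhds (∫⁻ w, coneWeight 1 w)) := by
    intro a ha
    rw [← hconst (∫⁻ w, coneWeight 1 w)]
    refine tendsto_lintegral_filter_of_dominated_convergence (fun _ => ∫⁻ w, coneWeight (1 / 2) w)
      (Eventually.of_forall fun n => (measurable_baseWeight hKm n).comp measurable_prodMk_left)
      ?_ (by rwa [hconst]) ?_
    · filter_upwards [eventually_ge_atTop 8] with n hn
      exact ae_of_all _ fun b => baseWeight_le hKm hn a b
    · have hne : ∀ᵐ b ∂volume.restrict K, b ≠ a := by simp [ae_iff]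
      filter_upwards [hint, hne] with b hb hba
      exact tendsto_baseWeight hK.1 hKm ha hb hba.symm
  rw [← hconst (∫⁻ w, coneWeight 1 w)]
  refine tendsto_lintegral_filter_of_dominated_convergence (fun _ => ∫⁻ w, coneWeight (1 / 2) w)
    (Eventually.of_forall fun n => (measurable_baseWeight hKm n).lintegral_prod_right')
    ?_ (by rwa [hconst]) ?_
  · filter_upwards [eventually_ge_atTop 8] with n hn
    refine ae_of_all _ fun a => ?_
    calc _ ≤ ∫⁻ _ in K, ∫⁻ w, coneWeight (1 / 2) w := lintegral_mono fun b => baseWeight_le hKm hn a b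
      _ = _ := hconst _
  · filter_upwards [hint] with a ha using hinner a ha

lemma unif_eq_restrict {K : Set (Euc 2)} (hvol : volume K = 1) : unif K = volume.restrict K := by
  rw [unif, hvol, inv_one, one_smul]

lemma restrict_compl_quadInterior {K : Set (Euc 2)} (hK : IsConvexBody K) (hvol : volume K = 1)
    {a b c d : Euc 2} (ha : a ∈ K) (hb : b ∈ K) (hc : c ∈ K) (hd : d ∈ K)
    (h : IsLongBaseQuad a b c d) : volume.restrict K (quadInterior a b c d)ᶜ
      = ENNReal.ofReal (1 - (orient a b c + orient a c d) / 2) := by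
  have hsub : quadInterior a b c d ⊆ K := by
    rw [← interior_convexHull_quad h]
    refine interior_subset.trans (convexHull_min ?_ hK.1)
    rintro p (rfl | rfl | rfl | rfl) <;> assumption
  have hm : MeasurableSet (quadInterior a b c d) := by
    rw [← interior_convexHull_quad h]
    exact isOpen_interior.measurableSet
  have hq := volume_quadInterior h
  have hpos : 0 ≤ (orient a b c + orient a c d) / 2 := by
    linarith [h.1.1, h.1.2.2.1]
  rw [Measure.restrict_apply hm.compl, Set.inter_comm, ← Set.sdiff_eq,
    measure_sdiff hsub hm.nullMeasurableSet (by rw [hq]; exact ENNReal.ofReal_ne_top), hvol, hq,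
    ENNReal.ofReal_sub _ hpos, ENNReal.ofReal_one]

open Classical in
lemma lintegral_restrict_eq_quadDensity {K : Set (Euc 2)} (hK : IsConvexBody K)
    (hvol : volume K = 1) (m : ℕ) {a b : Euc 2} (ha : a ∈ K) (hb : b ∈ K) :
    ∫⁻ c in K, ∫⁻ d in K, (if IsLongBaseQuad a b c d then
      volume.restrict K (quadInterior a b c d)ᶜ ^ m else 0)
      = ∫⁻ c, ∫⁻ d, quadDensity K m a b c d := by
  have hKm : MeasurableSet K := hK.2.1.isClosed.measurableSet
  simp only [← lintegral_indicator hKm]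
  refine lintegral_congr fun c => ?_
  by_cases hc : c ∈ K
  · rw [Set.indicator_of_mem hc]
    refine lintegral_congr fun d => ?_
    by_cases hd : d ∈ K
    · rw [Set.indicator_of_mem hd]
      by_cases h : IsLongBaseQuad a b c d
      · rw [if_pos h, quadDensity, if_pos ⟨hc, hd, h⟩,
          restrict_compl_quadInterior hK hvol ha hb hc hd h]
      · rw [if_neg h, quadDensity, if_neg fun h' => h h'.2.2]
    · rw [Set.indicator_of_notMem hd, quadDensity, if_neg fun h' => hd h'.2.1]
  · rw [Set.indicator_of_notMem hc]
    simp only [quadDensity, hc, false_and, if_false, lintegral_zero]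

lemma EHedge_eq_lintegral_baseWeight {K : Set (Euc 2)} (hK : IsConvexBody K) (hvol : volume K = 1)
    {n : ℕ} (hn : 4 ≤ n) : EHedge K n = (n.descFactorial 4 : ℝ) / (n : ℝ) ^ 2 *
      (∫⁻ a in K, ∫⁻ b in K, baseWeight K n a b).toReal := by
  have hKm : MeasurableSet K := hK.2.1.isClosed.measurableSet
  have hμ := unif_eq_restrict hvol
  have : IsProbabilityMeasure (unif K) :=
    ⟨by rw [hμ, Measure.restrict_apply_univ, hvol]⟩
  have hn0 : (0 : ℝ) < n := by exact_mod_cast (by omega : 0 < n)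
  have hac : unif K ≪ volume := hμ ▸ Measure.absolutelyContinuous_restrict
  rw [EHedge_eq hn hac fun e => measure_holeEvent (unif K) e, hμ]
  have hbw : ∫⁻ a in K, ∫⁻ b in K, baseWeight K n a b = ENNReal.ofReal ((n : ℝ) ^ 2) *
      ∫⁻ a in K, ∫⁻ b in K, ∫⁻ c, ∫⁻ d, quadDensity K (n - 4) a b c d := by
    simp only [baseWeight, lintegral_const_mul' _ _ ENNReal.ofReal_ne_top]
  rw [hbw, ENNReal.toReal_mul, ENNReal.toReal_ofReal (by positivity), ← mul_assoc,
    div_mul_cancel₀ _ (by positivity)]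
  congr 2
  refine setLIntegral_congr_fun hKm fun a ha => setLIntegral_congr_fun hKm fun b hb => ?_
  exact lintegral_restrict_eq_quadDensity hK hvol (n - 4) ha hb

lemma tendsto_descFactorial_four_div_pow :
    Tendsto (fun n : ℕ => (n.descFactorial 4 : ℝ) / (n : ℝ) ^ 4) atTop (nhds 1) := by
  have h (k : ℝ) : Tendsto (fun n : ℕ => 1 - k * (n : ℝ)⁻¹) atTop (nhds 1) := by
    simpa using tendsto_const_nhds.sub ((tendsto_inv_atTop_nhds_zero_nat (𝕜 := ℝ)).const_mul k)
  have := ((h 1).mul (h 2)).mul (h 3)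
  rw [mul_one, mul_one] at this
  refine this.congr' ?_
  filter_upwards [eventually_ge_atTop 4] with n hn
  have hn0 : (n : ℝ) ≠ 0 := by exact_mod_cast (by omega : n ≠ 0)
  simp only [Nat.descFactorial_succ, Nat.descFactorial_zero, mul_one]
  push_cast [Nat.cast_sub (show 1 ≤ n by omega), Nat.cast_sub (show 2 ≤ n by omega),
    Nat.cast_sub (show 3 ≤ n by omega), Nat.sub_zero]
  field_simp

/-- For every convex body `K ⊆ ℝ²` of unit area, the expected number `N₂(n)` of
4-holes whose maximum-distance pair forms an edge satisfies
`n^{-2} E[N₂(n)] → 8 - 2π²/3` as `n → ∞`. -/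
theorem statement15 (K : Set (Euc 2)) (hK : IsConvexBody K) (hvol : volume K = 1) :
    Filter.Tendsto (fun n : ℕ => EHedge K n / (n : ℝ) ^ 2) Filter.atTop
      (nhds (8 - 2 * Real.pi ^ 2 / 3)) := by
  have hval : (∫⁻ w, coneWeight 1 w).toReal = 8 - 2 * Real.pi ^ 2 / 3 := by
    have hpos : 0 ≤ 2 - Real.pi ^ 2 / 6 := by
      nlinarith [Real.pi_lt_d2, Real.pi_pos]
    rw [lintegral_coneWeight one_pos, ENNReal.toReal_mul, ENNReal.toReal_ofReal (by positivity),
      ENNReal.toReal_ofReal hpos]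
    ring
  have hfin : ∫⁻ w, coneWeight 1 w ≠ ⊤ := by
    rw [lintegral_coneWeight one_pos]
    exact ENNReal.mul_ne_top ENNReal.ofReal_ne_top ENNReal.ofReal_ne_top
  have hlim := tendsto_descFactorial_four_div_pow.mul
    ((ENNReal.tendsto_toReal hfin).comp (tendsto_lintegral_baseWeight hK hvol))
  rw [one_mul, hval] at hlim
  refine hlim.congr' ?_
  filter_upwards [eventually_ge_atTop 4] with n hn
  have hn0 : (n : ℝ) ≠ 0 := by exact_mod_cast (by omega : n ≠ 0)
  rw [EHedge_eq_lintegral_baseWeight hK hvol hn, Function.comp_apply]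
  field_simp
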